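/- arXiv:2512.07549 — 5 statements merged into one kernel-verified Lean document; each statement's English description precedes it below -/
import Mathlib

section
/- Let C be a unital C*-algebra with real rank zero, φ a state on C, and suppose (C,φ) is countably degree-1 saturated. Then the projection filter P_φ is downwards cofinal in the quantum filter F_φ: for every a ∈ F_φ there exists a projection p ∈ P_φ with p·a = p (equivalently p ≤ a). -/
open scoped ComplexOrder

noncomputable section

/-- A degree-1 *-polynomial over `C`. -/
structure Deg1Poly (C : Type*) [Ring C] [StarRing C] where
  m : ℕ
  n : ℕ
  const : C
  a1 : Fin m → Fin n → C
  a2 : Fin m → Fin n → C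
  a3 : Fin m → Fin n → C
  a4 : Fin m → Fin n → C

/-- Evaluation of a degree-1 *-polynomial:
`P(x̄) = Σ_{i,j} (a1 x_i a2 + a3 x_i* a4) + const`. -/
def Deg1Poly.eval {C : Type*} [Ring C] [StarRing C] (P : Deg1Poly C) (x : ℕ → C) : C :=
  (∑ i : Fin P.m, ∑ j : Fin P.n,
    (P.a1 i j * x (i : ℕ) * P.a2 i j + P.a3 i j * star (x (i : ℕ)) * P.a4 i j)) + P.const

variable {C : Type*} [CStarAlgebra C] [PartialOrder C] [StarOrderedRing C]

/-- A state on `C`. -/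
def IsState (φ : C →L[ℂ] ℂ) : Prop :=
  φ 1 = 1 ∧ ∀ a : C, 0 ≤ a → 0 ≤ φ a

/-- The quantum filter `F_φ` of a state `φ`. -/
def QuantumFilter (φ : C →L[ℂ] ℂ) : Set C := {a | 0 ≤ a ∧ ‖a‖ = 1 ∧ φ a = 1}

/-- The projection filter `P_φ` of a state `φ`. -/
def ProjFilter (φ : C →L[ℂ] ℂ) : Set C := {p | star p = p ∧ p * p = p ∧ φ p = 1}

/-- `(C, φ)` is countably degree-1 saturated: each condition is `‖P(x̄)‖ = s` or `φ(P(x̄)) = s`,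
encoded by a Boolean tag; every satisfiable countable collection of such conditions is
realized. -/
def PairCountablyDeg1Saturated (φ : C →L[ℂ] ℂ) : Prop :=
  ∀ (P : ℕ → Deg1Poly C) (isNorm : ℕ → Bool) (s : ℕ → ℂ),
    (∀ (F : Finset ℕ) (ε : ℝ), 0 < ε →
      ∃ b : ℕ → C, ∀ j ∈ F,
        ‖(if isNorm j then (‖(P j).eval b‖ : ℂ) else φ ((P j).eval b)) - s j‖ < ε) →
    ∃ b : ℕ → C, ∀ j,
      (if isNorm j then (‖(P j).eval b‖ : ℂ) else φ ((P j).eval b)) = s j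

/-- `C` has real rank zero: invertible self-adjoint elements are dense in the self-adjoint
elements. -/
def RealRankZero (C : Type*) [CStarAlgebra C] : Prop :=
  ∀ a : C, IsSelfAdjoint a → ∀ ε : ℝ, 0 < ε →
    ∃ b : C, IsSelfAdjoint b ∧ IsUnit b ∧ ‖a - b‖ < ε

section RealRankZero

variable {A : Type*} [CStarAlgebra A]

theorem exists_symmetry_of_isSelfAdjoint_of_isUnit {e : A} (he : IsSelfAdjoint e)
    (hu : IsUnit e) :
    ∃ s : A, IsSelfAdjoint s ∧ s * s = 1 ∧ ‖s‖ ≤ 1 ∧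
      ∀ t k : A, ‖s * t - k‖ ≤ ‖e * t - k‖ + ‖t - e * k‖ := by
  have hne : ∀ x ∈ spectrum ℝ e, x ≠ 0 := fun x hx h =>
    spectrum.zero_notMem ℝ hu (h ▸ hx)
  have hs : ContinuousOn (fun x : ℝ => x / |x|) (spectrum ℝ e) :=
    continuousOn_id.div continuous_abs.continuousOn fun x hx => abs_ne_zero.mpr (hne x hx)
  have hm : ContinuousOn (fun x : ℝ => |x| + 1) (spectrum ℝ e) := by fun_prop
  have hn : ContinuousOn (fun x : ℝ => (|x| + 1)⁻¹) (spectrum ℝ e) :=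
    hm.inv₀ fun x _ => by positivity
  have hid : cfc (fun x : ℝ => x) e = e := cfc_id' ℝ e
  set s := cfc (fun x : ℝ => x / |x|) e with hs_def
  set m := cfc (fun x : ℝ => |x| + 1) e with hm_def
  set n := cfc (fun x : ℝ => (|x| + 1)⁻¹) e with hn_def
  have hnorm : ‖s‖ ≤ 1 := norm_cfc_le zero_le_one fun x hx => by
    simp [div_self (abs_ne_zero.mpr (hne x hx))]
  have hnorm' : ‖n‖ ≤ 1 := norm_cfc_le zero_le_one fun x _ => by
    rw [Real.norm_eq_abs, abs_of_nonneg (by positivity)]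
    exact inv_le_one_of_one_le₀ (by linarith [abs_nonneg x])
  have hss : s * s = 1 := by
    rw [hs_def, ← cfc_mul _ _ e hs hs, ← cfc_one ℝ e]
    refine cfc_congr fun x hx => ?_
    have := abs_ne_zero.mpr (hne x hx)
    field_simp
    simp
  have hnm : n * m = 1 := by
    rw [hn_def, hm_def, ← cfc_mul _ _ e hn hm, ← cfc_one ℝ e]
    refine cfc_congr fun x _ => ?_
    have : |x| + 1 ≠ 0 := by positivity
    field_simp
    simp
  have hms : m * s = e + s := by
    have h1 : e + s = cfc (fun x : ℝ => x + x / |x|) e := by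
      rw [cfc_add (a := e) (fun x : ℝ => x) (fun x => x / |x|) continuousOn_id hs, hid]
    rw [h1, hm_def, hs_def, ← cfc_mul _ _ e hm hs]
    refine cfc_congr fun x hx => ?_
    have := abs_ne_zero.mpr (hne x hx)
    field_simp
  have hm' : m = s * e + 1 := by
    have h1 : s * e = cfc (fun x : ℝ => x / |x| * x) e := by
      rw [cfc_mul (fun x : ℝ => x / |x|) (fun x => x) e hs continuousOn_id, hid]
    rw [h1, hm_def, cfc_add_const 1 (fun x : ℝ => |x|) e, map_one]
    congr 1
    refine cfc_congr fun x hx => ?_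
    have := abs_ne_zero.mpr (hne x hx)
    field_simp
    simp
  refine ⟨s, IsSelfAdjoint.cfc, hss, hnorm, fun t k => ?_⟩
  have key : s * t - k = n * ((e * t - k) + s * (t - e * k)) := by
    have : m * (s * t - k) = (e * t - k) + s * (t - e * k) := by
      rw [mul_sub, ← mul_assoc, hms, hm']
      noncomm_ring
    rw [← this, ← mul_assoc, hnm, one_mul]
  rw [key]
  calc _ ≤ ‖n‖ * ‖(e * t - k) + s * (t - e * k)‖ := norm_mul_le _ _
    _ ≤ 1 * ‖(e * t - k) + s * (t - e * k)‖ := by gcongr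
    _ ≤ ‖e * t - k‖ + ‖s * (t - e * k)‖ := by rw [one_mul]; exact norm_add_le _ _
    _ ≤ ‖e * t - k‖ + ‖s‖ * ‖t - e * k‖ := by gcongr; exact norm_mul_le _ _
    _ ≤ ‖e * t - k‖ + 1 * ‖t - e * k‖ := by gcongr
    _ = _ := by rw [one_mul]

/-- In real rank zero, `h` can be replaced by a symmetry agreeing exactly with it on the part
where `t` acts as a unit. -/
theorem RealRankZero.exists_symmetry (hrr : RealRankZero A) {h t k : A}
    (hh : IsSelfAdjoint h) (ht : IsSelfAdjoint t) (hk : IsSelfAdjoint k)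
    (ht1 : ‖t‖ ≤ 1) (hk1 : ‖k‖ ≤ 1) (hht : h * t = k) (hhk : h * k = t) (htk : Commute t k) :
    ∃ s : A, IsSelfAdjoint s ∧ s * s = 1 ∧
      ∀ x : A, t * x = x → k * (k * x) = x → s * x = k * x := by
  obtain ⟨e, he, heu, hne⟩ := hrr h hh (1 / 7) (by norm_num)
  obtain ⟨s, hs, hss, hs1, hst⟩ := exists_symmetry_of_isSelfAdjoint_of_isUnit he heu
  have hδ : ‖s * t - k‖ ≤ 2 / 7 := by
    have h1 : ‖e * t - k‖ ≤ 1 / 7 := by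
      rw [← hht, ← sub_mul]
      calc _ ≤ ‖e - h‖ * ‖t‖ := norm_mul_le _ _
        _ ≤ 1 / 7 * 1 := by rw [norm_sub_rev]; gcongr
        _ = _ := by norm_num
    have h2 : ‖t - e * k‖ ≤ 1 / 7 := by
      rw [← hhk, ← sub_mul]
      calc _ ≤ ‖h - e‖ * ‖k‖ := norm_mul_le _ _
        _ ≤ 1 / 7 * 1 := by gcongr
        _ = _ := by norm_num
    linarith [hst t k]
  have hδ' : ‖t * s - k‖ ≤ 2 / 7 := by
    rw [← norm_star]
    simpa [hs.star_eq, ht.star_eq, hk.star_eq] using hδ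
  set c := (1 - t) * s * (1 - t) + (k + k) - t * k with hc
  have hcs : IsSelfAdjoint c := by
    have h1 : IsSelfAdjoint (1 - t) := (IsSelfAdjoint.one A).sub ht
    have h2 : IsSelfAdjoint ((1 - t) * s * (1 - t)) := by
      simpa [h1.star_eq] using hs.conjugate (1 - t)
    exact (h2.add (hk.add hk)).sub ((ht.commute_iff hk).mp htk)
  have hcsn : ‖c - s‖ < 1 := by
    have h1 : c - s = t * (s * t - k) - (s * t - k) - (t * s - k) := by
      rw [hc]; noncomm_ring
    have h2 : ‖t * (s * t - k)‖ ≤ 1 * (2 / 7) :=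
      (norm_mul_le _ _).trans (by gcongr)
    rw [h1]
    linarith [norm_sub_le (t * (s * t - k) - (s * t - k)) (t * s - k),
      norm_sub_le (t * (s * t - k)) (s * t - k)]
  have hcu : IsUnit c := by
    have h1 : IsUnit (s * c) := by
      have h2 : ‖-(s * (c - s))‖ < 1 := by
        rw [norm_neg]
        calc _ ≤ ‖s‖ * ‖c - s‖ := norm_mul_le _ _
          _ ≤ 1 * ‖c - s‖ := by gcongr
          _ < 1 := by rwa [one_mul]
      have := isUnit_one_sub_of_norm_lt_one h2
      rwa [sub_neg_eq_add, mul_sub, hss, add_sub_cancel] at this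
    have h3 : c = s * (s * c) := by rw [← mul_assoc, hss, one_mul]
    rw [h3]
    exact (show IsUnit s from ⟨⟨s, s, hss, hss⟩, rfl⟩).mul h1
  obtain ⟨r, hr, hrr', -, hrt⟩ := exists_symmetry_of_isSelfAdjoint_of_isUnit hcs hcu
  refine ⟨r, hr, hrr', fun x hx hkx => ?_⟩
  have hcx : ∀ y, t * y = y → c * y = k * y := fun y hy => by
    have h1 : (1 - t) * y = 0 := by rw [sub_mul, one_mul, hy, sub_self]
    rw [hc, htk.eq, sub_mul, add_mul, mul_assoc _ _ y, h1, mul_assoc k t, hy]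
    noncomm_ring
  have htkx : t * (k * x) = k * x := by rw [← mul_assoc, htk.eq, mul_assoc, hx]
  have := hrt x (k * x)
  rw [hcx x hx, hcx _ htkx, hkx, sub_self, sub_self, norm_zero, add_zero] at this
  exact sub_eq_zero.mp (norm_le_zero_iff.mp this)

theorem RealRankZero.exists_projection (hrr : RealRankZero A) (d : A) :
    ∃ p : A, IsSelfAdjoint p ∧ p * p = p ∧
      p * cfc (fun x : ℝ => max 0 (1 - 6 * (1 - x))) d =
        cfc (fun x : ℝ => max 0 (1 - 6 * (1 - x))) d ∧
      p * cfc (fun x : ℝ => max 0 (1 - 6 * x)) d = 0 := by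
  let H : ℝ → ℝ := fun x => max (-1) (min 1 (6 * x - 3))
  let Z : ℝ → ℝ := fun x => max 0 (min 1 (6 * x - 4))
  let Y : ℝ → ℝ := fun x => max 0 (min 1 (2 - 6 * x))
  let T : ℝ → ℝ := fun x => Z x + Y x
  let K : ℝ → ℝ := fun x => Z x - Y x
  let f : ℝ → ℝ := fun x => max 0 (1 - 6 * (1 - x))
  let g : ℝ → ℝ := fun x => max 0 (1 - 6 * x)
  have cH : Continuous H := by fun_prop
  have cT : Continuous T := by fun_prop
  have cK : Continuous K := by fun_prop
  have cf : Continuous f := by fun_prop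
  have cg : Continuous g := by fun_prop
  have hmul : ∀ F G J : ℝ → ℝ, Continuous F → Continuous G → (∀ x, F x * G x = J x) →
      cfc F d * cfc G d = cfc J d := fun F G J hF hG hJ => by
    rw [← cfc_mul F G d hF.continuousOn hG.continuousOn]
    exact cfc_congr fun x _ => hJ x
  have hHZY : ∀ x : ℝ, (H x = -1 ∧ Z x = 0) ∨ (H x = 1 ∧ Y x = 0) ∨ (Z x = 0 ∧ Y x = 0) :=
    fun x => by
    simp only [H, Z, Y]
    grind
  have hf : ∀ x, Z x * f x = f x := fun x => by simp only [Z, f]; grind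
  have hg : ∀ x, Y x * g x = g x := fun x => by simp only [Y, g]; grind
  have hYf : ∀ x, Y x * f x = 0 := fun x => by simp only [Y, f]; grind
  have hZg : ∀ x, Z x * g x = 0 := fun x => by simp only [Z, g]; grind
  have hTb : ∀ x, ‖T x‖ ≤ 1 := fun x => by
    rw [Real.norm_eq_abs, abs_le]; simp only [T, Z, Y]; grind
  have hKb : ∀ x, ‖K x‖ ≤ 1 := fun x => by
    rw [Real.norm_eq_abs, abs_le]; simp only [K, Z, Y]; grind
  have hKf : cfc K d * cfc f d = cfc f d :=
    hmul _ _ _ cK cf fun x => by simp only [K]; linear_combination hf x - hYf x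
  have hKg : cfc K d * cfc g d = -cfc g d := by
    rw [← cfc_neg]
    exact hmul _ _ _ cK cg fun x => by simp only [K]; linear_combination hZg x - hg x
  obtain ⟨s, hs, hss, hsx⟩ := hrr.exists_symmetry (h := cfc H d) (t := cfc T d) (k := cfc K d)
    IsSelfAdjoint.cfc IsSelfAdjoint.cfc IsSelfAdjoint.cfc
    (norm_cfc_le zero_le_one fun x _ => hTb x) (norm_cfc_le zero_le_one fun x _ => hKb x)
    (hmul _ _ _ cH cT fun x => by simp only [T, K]; grind)
    (hmul _ _ _ cH cK fun x => by simp only [T, K]; grind)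
    (cfc_commute_cfc _ _ _)
  have hsf : s * cfc f d = cfc f d := by
    rw [hsx, hKf]
    · exact hmul _ _ _ cT cf fun x => by simp only [T]; linear_combination hf x + hYf x
    · rw [hKf, hKf]
  have hsg : s * cfc g d = -cfc g d := by
    rw [hsx, hKg]
    · exact hmul _ _ _ cT cg fun x => by simp only [T]; linear_combination hg x + hZg x
    · rw [hKg, mul_neg, hKg, neg_neg]
  refine ⟨(1 / 2 : ℝ) • (1 + s), ?_, ?_, ?_, ?_⟩
  · exact (IsSelfAdjoint.all (1 / 2 : ℝ)).smul ((IsSelfAdjoint.one A).add hs)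
  · rw [smul_mul_smul_comm, mul_add, add_mul, add_mul, hss]
    simp only [one_mul, mul_one]
    module
  · change _ * cfc f d = cfc f d
    rw [smul_mul_assoc, add_mul, hsf, one_mul]
    module
  · change _ * cfc g d = 0
    rw [smul_mul_assoc, add_mul, hsg, one_mul]
    module

end RealRankZero

section State

variable {A : Type*} [CStarAlgebra A] [PartialOrder A] [StarOrderedRing A] {φ : A →L[ℂ] ℂ}

theorem spectrum_subset_Icc_of_nonneg_of_le_one {d : A} (h0 : 0 ≤ d) (h1 : d ≤ 1) :
    spectrum ℝ d ⊆ Set.Icc 0 1 := fun x hx =>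
  ⟨spectrum_nonneg_of_nonneg h0 hx, (CFC.le_one_iff (R := ℝ) d).mp h1 x hx⟩

theorem IsState.mono (hφ : IsState φ) {a b : A} (h : a ≤ b) : φ a ≤ φ b := by
  simpa using hφ.2 (b - a) (sub_nonneg.mpr h)

theorem IsState.eq_one_of_le (hφ : IsState φ) {a b : A} (h : a ≤ b) (hb : b ≤ 1)
    (ha : φ a = 1) : φ b = 1 :=
  le_antisymm (hφ.1 ▸ hφ.mono hb) (ha ▸ hφ.mono h)

theorem IsState.apply_cfc_eq_one (hφ : IsState φ) {d : A} (h0 : 0 ≤ d) (h1 : d ≤ 1)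
    (hd : φ d = 1) (M : ℝ) (hM : 0 ≤ M) :
    φ (cfc (fun x : ℝ => max 0 (1 - M * (1 - x))) d) = 1 := by
  have hsp := spectrum_subset_Icc_of_nonneg_of_le_one h0 h1
  have hsa : IsSelfAdjoint d := .of_nonneg h0
  refine hφ.eq_one_of_le (a := 1 - M • (1 - d)) ?_ (cfc_le_one _ _ fun x hx => ?_) ?_
  · have : 1 - M • (1 - d) = cfc (fun x : ℝ => 1 - M * (1 - x)) d := by
      rw [cfc_sub (a := d) (fun _ => (1 : ℝ)) (fun x => M * (1 - x)), cfc_const_mul M _ d,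
        cfc_sub (a := d) (fun _ => (1 : ℝ)) (fun x => x), cfc_id' ℝ d, cfc_const_one ℝ d]
    rw [this]
    exact cfc_mono fun x _ => le_max_right _ _
  · exact max_le zero_le_one (by nlinarith [(hsp hx).2])
  · rw [← Complex.coe_smul, map_sub, map_smul, map_sub, hφ.1, hd]
    simp

theorem IsState.one_le_norm (hφ : IsState φ) {a : A} (ha : 0 ≤ a) (h : φ a = 1) : 1 ≤ ‖a‖ := by
  have := hφ.mono (IsSelfAdjoint.le_algebraMap_norm_self (.of_nonneg ha))
  rw [h, Algebra.algebraMap_eq_smul_one, ← Complex.coe_smul, map_smul, hφ.1, smul_eq_mul,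
    mul_one] at this
  exact_mod_cast this

theorem le_one_of_mem_quantumFilter {a : A} (ha : a ∈ QuantumFilter φ) : a ≤ 1 :=
  (CStarAlgebra.norm_le_one_iff_of_nonneg a ha.1).mp ha.2.1.le

theorem IsState.exists_approx (hφ : IsState φ) {a : A} (ha : a ∈ QuantumFilter φ) {ε : ℝ}
    (hε : 0 < ε) :
    ∃ b : A, IsSelfAdjoint b ∧ ‖b‖ = 1 ∧ φ b = 1 ∧ ‖b * (a - 1)‖ < ε := by
  have h1 := le_one_of_mem_quantumFilter ha
  have hsp := spectrum_subset_Icc_of_nonneg_of_le_one ha.1 h1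
  have hsa : IsSelfAdjoint a := .of_nonneg ha.1
  set M : ℝ := 2 / ε with hM
  have hM0 : 0 < M := by positivity
  have hMε : M * ε = 2 := by rw [hM]; field_simp
  set f : ℝ → ℝ := fun x => max 0 (1 - M * (1 - x)) with hf
  have hb : φ (cfc f a) = 1 := hφ.apply_cfc_eq_one ha.1 h1 ha.2.2 M hM0.le
  have hf1 : ∀ x ∈ spectrum ℝ a, f x ≤ 1 := fun x hx =>
    max_le zero_le_one (by nlinarith [(hsp hx).2])
  have hnn : 0 ≤ cfc f a := cfc_nonneg fun x _ => le_max_left _ _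
  refine ⟨cfc f a, IsSelfAdjoint.cfc, le_antisymm ?_ (hφ.one_le_norm hnn hb), hb, ?_⟩
  · exact (CStarAlgebra.norm_le_one_iff_of_nonneg _ hnn).mpr (cfc_le_one _ _ hf1)
  · have : cfc f a * (a - 1) = cfc (fun x => f x * (x - 1)) a := by
      rw [cfc_mul f (fun x => x - 1) a, cfc_sub (a := a) (fun x => x) (fun _ => (1 : ℝ)),
        cfc_id' ℝ a, cfc_const_one ℝ a]
    rw [this]
    refine (norm_cfc_le (c := ε / 2) (by positivity) fun x hx => ?_).trans_lt (by linarith)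
    have hx1 := (hsp hx).2
    rw [Real.norm_eq_abs, abs_mul, abs_of_nonneg (le_max_left _ _), abs_of_nonpos (by linarith)]
    rcases le_total (1 - M * (1 - x)) 0 with h | h
    · simp only [hf, max_eq_left h]
      linarith
    · have h2 : 1 - x ≤ ε / 2 := by nlinarith
      nlinarith [hf1 x hx]

theorem IsState.exists_mul_eq_self (hφ : IsState φ) (hsat : PairCountablyDeg1Saturated φ)
    {a : A} (ha : a ∈ QuantumFilter φ) :
    ∃ d : A, 0 ≤ d ∧ d ≤ 1 ∧ φ d = 1 ∧ d * a = d := by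
  let lin (u v w : A) : Deg1Poly A :=
    ⟨1, 1, 0, fun _ _ => u, fun _ _ => v, fun _ _ => w, fun _ _ => 1⟩
  have hlin : ∀ u v w x, (lin u v w).eval x = u * x 0 * v + w * star (x 0) := fun u v w x => by
    simp [lin, Deg1Poly.eval]
  let P : ℕ → Deg1Poly A
    | 0 => lin 1 (a - 1) 0
    | 1 => lin 1 1 0
    | 2 => lin 1 1 0
    | _ => lin 0 1 1
  let N : ℕ → Bool
    | 0 => true
    | 1 => true
    | _ => false
  let s : ℕ → ℂ
    | 0 => 0
    | _ => 1
  obtain ⟨b, hb⟩ := hsat P N s (fun F ε hε => by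
    obtain ⟨b, hbs, hb1, hφb, hba⟩ := hφ.exists_approx ha hε
    refine ⟨fun _ => b, fun j _ => ?_⟩
    match j with
    | 0 => simpa [P, N, s, hlin] using hba
    | 1 => simpa [P, N, s, hlin, hb1] using hε
    | 2 => simpa [P, N, s, hlin, hφb] using hε
    | _ + 3 => simpa [P, N, s, hlin, hbs.star_eq, hφb] using hε)
  set x := b 0 with hx
  have hb0 : x * a = x := by
    have := hb 0
    simp only [P, N, s, hlin] at this
    simpa [mul_sub, sub_eq_zero] using this
  have hb1 : ‖x‖ = 1 := by
    have := hb 1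
    simp only [P, N, s, hlin] at this
    simpa using this
  have hb2 : φ x = 1 := by
    have := hb 2
    simp only [P, N, s, hlin] at this
    simpa using this
  have hb3 : φ (star x) = 1 := by
    have := hb 3
    simp only [P, N, s, hlin] at this
    simpa using this
  have hle : star x * x ≤ 1 := by
    rw [← CStarAlgebra.norm_le_one_iff_of_nonneg _ (star_mul_self_nonneg x),
      CStarRing.norm_star_mul_self, hb1, one_mul]
  refine ⟨star x * x, star_mul_self_nonneg x, hle, ?_, by rw [mul_assoc, hb0]⟩
  refine hφ.eq_one_of_le (a := x + star x - 1) ?_ hle (by simp [hb2, hb3, hφ.1])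
  have := star_mul_self_nonneg (x - 1)
  rw [← sub_nonneg]
  convert this using 1
  simp only [star_sub, star_one]
  noncomm_ring

end State

/-- If `C` is a unital C*-algebra of real rank zero, `φ` is a state on `C`, and
`(C, φ)` is countably degree-1 saturated, then `P_φ` is downwards cofinal in `F_φ`. -/
theorem projFilter_cofinal_in_quantumFilter
    (hrr : RealRankZero C) (φ : C →L[ℂ] ℂ) (hstate : IsState φ)
    (hsat : PairCountablyDeg1Saturated φ) :
    ∀ a ∈ QuantumFilter φ, ∃ p ∈ ProjFilter φ, p * a = p ∧ p ≤ a := by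
  intro a ha
  obtain ⟨d, hd0, hd1, hφd, hda⟩ := hstate.exists_mul_eq_self hsat ha
  obtain ⟨p, hp, hpp, hpf, hpg⟩ := hrr.exists_projection d
  have hpa : p * (1 - a) = 0 := by
    have hc : ContinuousOn (fun x : ℝ => 6 / max 1 (6 * x)) (spectrum ℝ d) :=
      ContinuousOn.div (by fun_prop) (by fun_prop) fun x _ =>
        (zero_lt_one.trans_le (le_max_left _ _)).ne'
    have h1 : cfc (fun x : ℝ => max 0 (1 - 6 * x)) d =
        1 - cfc (fun x : ℝ => 6 / max 1 (6 * x)) d * d := by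
      have hsa : IsSelfAdjoint d := .of_nonneg hd0
      conv_rhs => rw [← cfc_const_one ℝ d]; enter [2, 2]; rw [← cfc_id' ℝ d]
      rw [← cfc_mul _ _ d, ← cfc_sub (a := d) _ _]
      refine cfc_congr fun x _ => ?_
      rcases le_total 1 (6 * x) with h | h
      · rw [max_eq_right h, max_eq_left (by linarith)]
        have : x ≠ 0 := by rintro rfl; norm_num at h
        field_simp
        simp
      · rw [max_eq_left h, max_eq_right (by linarith)]
        ring
    have h2 : cfc (fun x : ℝ => max 0 (1 - 6 * x)) d * (1 - a) = 1 - a := by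
      rw [h1, sub_mul, mul_assoc, mul_sub d, hda]
      simp
    rw [← h2, ← mul_assoc, hpg, zero_mul]
  have hpa' : p * a = p := by
    rw [mul_sub, mul_one, sub_eq_zero] at hpa
    exact hpa.symm
  have hap : a * p = p := by
    simpa [hp.star_eq, (IsSelfAdjoint.of_nonneg ha.1).star_eq] using congrArg star hpa'
  have hp1 : IsSelfAdjoint (1 - p) := (IsSelfAdjoint.one C).sub hp
  refine ⟨p, ⟨hp, hpp, ?_⟩, hpa', ?_⟩
  · set f := cfc (fun x : ℝ => max 0 (1 - 6 * (1 - x))) d with hf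
    have hf1 : f ≤ 1 := cfc_le_one _ _ fun x hx =>
      max_le zero_le_one
        (by linarith [(spectrum_subset_Icc_of_nonneg_of_le_one hd0 hd1 hx).2])
    have hfs : IsSelfAdjoint f := IsSelfAdjoint.cfc
    have hfp : f * p = f := by
      simpa [hp.star_eq, hfs.star_eq] using congrArg star hpf
    refine hstate.eq_one_of_le (a := f) ?_ ?_ (hstate.apply_cfc_eq_one hd0 hd1 hφd 6 (by norm_num))
    · have := hp.conjugate_nonneg (sub_nonneg.mpr hf1)
      rwa [mul_sub, mul_one, hpf, sub_mul, hpp, hfp, sub_nonneg] at this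
    · have := star_mul_self_nonneg (1 - p)
      rw [hp1.star_eq, mul_sub, sub_mul, sub_mul, hpp] at this
      simpa using this
  · have := hp1.conjugate_nonneg ha.1
    have h2 : (1 - p) * a * (1 - p) = a - p := by
      rw [sub_mul, hpa', one_mul, mul_sub, mul_one, sub_mul, hap, hpp, sub_self, sub_zero]
    rwa [h2, sub_nonneg] at this

end
end

section
/- Let C be a unital C*-algebra with real rank zero and φ a state on C. If the projection filter P_φ is a P-filter (every countable subset of P_φ has a lower bound in P_φ under ≤), then the quantum filter F_φ is a P-filter under ≪; in fact, for every sequence (a_n) in F_φ there exists a projection p ∈ P_φ with p·a_n = p for all n. -/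
open scoped ComplexOrder

noncomputable section

variable {C : Type*} [CStarAlgebra C] [PartialOrder C] [StarOrderedRing C]

/-- A step function is continuous on every set that avoids its jump. -/
lemma continuousOn_ite_lt {c : ℝ} {s : Set ℝ} (hc : c ∉ s) :
    ContinuousOn (fun t : ℝ => if c < t then (1 : ℝ) else 0) s := by
  intro t ht
  apply ContinuousAt.continuousWithinAt
  rcases lt_or_gt_of_ne (fun h : t = c => hc (h ▸ ht)) with h | h
  · refine (continuousAt_const (y := (0 : ℝ))).congr ?_
    filter_upwards [Iio_mem_nhds h] with u hu
    simp [not_lt.mpr (le_of_lt (Set.mem_Iio.mp hu))]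
  · refine (continuousAt_const (y := (1 : ℝ))).congr ?_
    filter_upwards [Ioi_mem_nhds h] with u hu
    simp [Set.mem_Ioi.mp hu]

/-- The spectral projection of a self-adjoint element for an interval `(c, ∞)` whose endpoint is
not in the spectrum. -/
lemma isStarProjection_cfc_ite_lt {A : Type*} [CStarAlgebra A] {b : A} {c : ℝ} (hc : c ∉ spectrum ℝ b) :
    IsStarProjection (cfc (fun t : ℝ => if c < t then (1 : ℝ) else 0) b) := by
  have hcont := continuousOn_ite_lt hc
  refine ⟨?_, cfc_predicate _ b⟩
  rw [IsIdempotentElem, ← cfc_mul _ _ b hcont hcont]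
  congr 1
  ext t
  split_ifs <;> simp

/-- The positive spectral projection of an invertible self-adjoint element almost fixes the
vectors on which `b` is close to `1` and almost annihilates those on which `b` is close to
`-1`. -/
lemma exists_isStarProjection_norm_mul_le {A : Type*} [CStarAlgebra A] {b : A}
    (hb : IsSelfAdjoint b) (hu : IsUnit b) :
    ∃ p : A, IsStarProjection p ∧ (∀ y, ‖p * y‖ ≤ ‖(b + 1) * y‖) ∧
      ∀ y, ‖(1 - p) * y‖ ≤ ‖(b - 1) * y‖ := by
  have h0 : (0 : ℝ) ∉ spectrum ℝ b := (spectrum.zero_notMem_iff ℝ).2 hu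
  set f : ℝ → ℝ := fun t => if 0 < t then 1 else 0 with hf
  have hfc : ContinuousOn f (spectrum ℝ b) := continuousOn_ite_lt h0
  have hgc : Continuous fun t : ℝ => (1 + |t|)⁻¹ := by
    refine Continuous.inv₀ (by fun_prop) fun t => by positivity
  have hg1 (t : ℝ) : (1 + |t|)⁻¹ ≤ 1 := inv_le_one_of_one_le₀ (by simp)
  have hg0 (t : ℝ) : 0 ≤ (1 + |t|)⁻¹ := by positivity
  have hF : ContinuousOn (fun t => f t * (1 + |t|)⁻¹) (spectrum ℝ b) :=
    hfc.mul hgc.continuousOn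
  have hG : ContinuousOn (fun t => (f t - 1) * (1 + |t|)⁻¹) (spectrum ℝ b) :=
    (hfc.sub continuousOn_const).mul hgc.continuousOn
  have e1 : cfc f b = cfc (fun t => f t * (1 + |t|)⁻¹) b * (b + 1) := by
    have : b + 1 = cfc (fun t : ℝ => t + 1) b := by
      rw [cfc_add_const (1 : ℝ) (fun t => t) b, cfc_id' ℝ b, map_one]
    rw [this, ← cfc_mul _ _ b hF (by fun_prop)]
    refine cfc_congr fun t _ => ?_
    by_cases ht : 0 < t
    · have : 1 + t ≠ 0 := by positivity
      simp [hf, ht, abs_of_pos ht]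
      field_simp
      ring
    · simp [hf, ht]
  have e2 : 1 - cfc f b = cfc (fun t => (f t - 1) * (1 + |t|)⁻¹) b * (b - 1) := by
    have h1 : b - 1 = cfc (fun t : ℝ => t - 1) b := by
      rw [cfc_sub (fun t : ℝ => t) (fun _ => 1) b, cfc_id' ℝ b, cfc_const_one ℝ b]
    have h2 : 1 - cfc f b = cfc (fun t => 1 - f t) b := by
      rw [cfc_sub (fun _ => 1) f b, cfc_const_one ℝ b]
    rw [h1, h2, ← cfc_mul _ _ b hG (by fun_prop)]
    refine cfc_congr fun t _ => ?_
    by_cases ht : 0 < t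
    · simp [hf, ht]
    · have h3 : 1 - t ≠ 0 := by linarith [not_lt.mp ht]
      have h4 : 1 + -t ≠ 0 := by linarith [not_lt.mp ht]
      simp [hf, ht, abs_of_nonpos (not_lt.mp ht)]
      field_simp
      ring
  refine ⟨cfc f b, isStarProjection_cfc_ite_lt h0, fun y => ?_, fun y => ?_⟩
  · rw [e1, mul_assoc]
    refine (norm_mul_le _ _).trans (mul_le_of_le_one_left (norm_nonneg _) ?_)
    refine norm_cfc_le zero_le_one fun t _ => ?_
    rw [norm_mul, Real.norm_of_nonneg (hg0 t)]
    refine mul_le_one₀ ?_ (hg0 t) (hg1 t)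
    by_cases ht : 0 < t <;> simp [hf, ht]
  · rw [e2, mul_assoc]
    refine (norm_mul_le _ _).trans (mul_le_of_le_one_left (norm_nonneg _) ?_)
    refine norm_cfc_le zero_le_one fun t _ => ?_
    rw [norm_mul, Real.norm_of_nonneg (hg0 t)]
    refine mul_le_one₀ ?_ (hg0 t) (hg1 t)
    by_cases ht : 0 < t <;> simp [hf, ht]

lemma IsStarProjection.norm_le_one {p : C} (hp : IsStarProjection p) : ‖p‖ ≤ 1 :=
  (CStarAlgebra.norm_le_one_iff_of_nonneg p hp.nonneg).2 hp.le_one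

/-- A positive element `z` close to a projection is close to a projection dominated by a
multiple of `z`. -/
lemma exists_isStarProjection_le_two_smul {z P : C} (hz : 0 ≤ z) (hP : IsStarProjection P) {δ : ℝ}
    (hδ : δ ≤ 1 / 20) (h : ‖z - P‖ ≤ δ) :
    ∃ Q : C, IsStarProjection Q ∧ ‖Q - P‖ ≤ 9 * δ ∧ Q ≤ (2 : ℝ) • z := by
  have hδ0 : 0 ≤ δ := (norm_nonneg _).trans h
  have hzs : IsSelfAdjoint z := .of_nonneg hz
  have hzz : ‖z * z - z‖ ≤ 4 * δ := by
    have e : z * z - z = P * (z - P) + (z - P) * P + (z - P) * (z - P) - (z - P) := by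
      have := hP.isIdempotentElem.eq
      simp only [mul_sub, sub_mul, this]
      abel
    have h1 : ‖P * (z - P)‖ ≤ δ :=
      (norm_mul_le _ _).trans
        ((mul_le_of_le_one_left (norm_nonneg _) hP.norm_le_one).trans h)
    have h2 : ‖(z - P) * P‖ ≤ δ :=
      (norm_mul_le _ _).trans
        ((mul_le_of_le_one_right (norm_nonneg _) hP.norm_le_one).trans h)
    have h3 : ‖(z - P) * (z - P)‖ ≤ δ :=
      (norm_mul_le _ _).trans
        ((mul_le_of_le_one_right (norm_nonneg _) (by linarith)).trans h)
    rw [e]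
    refine (norm_sub_le _ _).trans ?_
    linarith [norm_add₃_le (a := P * (z - P)) (b := (z - P) * P) (c := (z - P) * (z - P))]
  have hspec : ∀ t ∈ spectrum ℝ z, |t * t - t| ≤ 4 * δ := by
    intro t ht
    have e : z * z - z = cfc (fun t : ℝ => t * t - t) z := by
      rw [cfc_sub (fun t : ℝ => t * t) (fun t => t) z, cfc_mul (fun t : ℝ => t) (fun t => t) z,
        cfc_id' ℝ z]
    rw [e, norm_cfc_le_iff _ _ (by positivity)] at hzz
    exact hzz t ht
  have hhalf : (1 / 2 : ℝ) ∉ spectrum ℝ z := by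
    intro ht
    have := hspec _ ht
    norm_num [abs_of_neg] at this
    linarith
  have hnonneg : ∀ t ∈ spectrum ℝ z, 0 ≤ t := fun t ht => spectrum_nonneg_of_nonneg hz ht
  have hfc := continuousOn_ite_lt hhalf
  refine ⟨_, isStarProjection_cfc_ite_lt hhalf, ?_, ?_⟩
  · have key : ‖cfc (fun t : ℝ => if 1 / 2 < t then (1 : ℝ) else 0) z - z‖ ≤ 8 * δ := by
      nth_rewrite 2 [← cfc_id' ℝ z]
      rw [← cfc_sub _ _ z hfc (by fun_prop)]
      refine norm_cfc_le (by positivity) fun t ht => ?_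
      have h1 := hspec t ht
      have h0 := hnonneg t ht
      rw [abs_le] at h1
      rw [Real.norm_eq_abs, abs_le]
      split_ifs with hlt
      · constructor <;> nlinarith
      · constructor <;> nlinarith
    calc _ ≤ _ + ‖z - P‖ := norm_sub_le_norm_sub_add_norm_sub _ z _
      _ ≤ 9 * δ := by linarith
  · have e : (2 : ℝ) • z = cfc (fun t : ℝ => 2 * t) z := (cfc_const_mul_id 2 z).symm
    rw [e]
    refine cfc_mono (fun t ht => ?_) hfc (by fun_prop)
    have h0 := hnonneg t ht
    split_ifs <;> linarith

lemma IsState.monotone {φ : C →L[ℂ] ℂ} (hφ : IsState φ) : Monotone φ := by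
  intro a b hab
  have := hφ.2 (b - a) (sub_nonneg.2 hab)
  rwa [map_sub, sub_nonneg] at this

lemma IsState.apply_eq_zero_of_le_smul {φ : C →L[ℂ] ℂ} (hφ : IsState φ) {a w : C} {r : ℝ}
    (ha : 0 ≤ a) (haw : a ≤ r • w) (hw : φ w = 0) : φ a = 0 := by
  refine le_antisymm ?_ (hφ.2 a ha)
  have := hφ.monotone haw
  rwa [← Complex.coe_smul, map_smul, hw, smul_zero] at this

/-- Cutoffs of a positive element `w`: `h` is `1` on the support of `1 - k` and `-1` away from
small spectral values of `w`, while `k` vanishes on the kernel of `w`. -/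
lemma exists_cutoffs {w : C} (hw : 0 ≤ w) {ε : ℝ} (hε : 0 < ε) :
    ∃ h k : C, IsSelfAdjoint h ∧ IsSelfAdjoint k ∧ ‖1 - k‖ ≤ 1 ∧ h * (1 - k) = 1 - k ∧
      ‖(h + 1) * w‖ ≤ 2 * ε ∧ k * k ≤ (2 / ε) • w := by
  have hws : IsSelfAdjoint w := .of_nonneg hw
  have hsp : ∀ t ∈ spectrum ℝ w, 0 ≤ t := fun t ht => spectrum_nonneg_of_nonneg hw ht
  obtain ⟨H, hH⟩ : ∃ H : ℝ → ℝ, ∀ t, H t = max (-1) (min 1 (3 - 4 * t / ε)) := ⟨_, fun _ => rfl⟩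
  obtain ⟨K, hK⟩ : ∃ K : ℝ → ℝ, ∀ t, K t = min 1 (2 * t / ε) := ⟨_, fun _ => rfl⟩
  have hHc : Continuous H := by rw [funext hH]; fun_prop
  have hKc : Continuous K := by rw [funext hK]; fun_prop
  have hKle (t : ℝ) : K t ≤ 1 := hK t ▸ min_le_left _ _
  have hK0 : ∀ t ∈ spectrum ℝ w, 0 ≤ K t := fun t ht =>
    hK t ▸ le_min zero_le_one (by have := hsp t ht; positivity)
  have hxe : 1 - cfc K w = cfc (fun t => 1 - K t) w := by
    rw [cfc_sub (fun _ => 1) K w, cfc_const_one ℝ w]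
  refine ⟨cfc H w, cfc K w, cfc_predicate _ _, cfc_predicate _ _, ?_, ?_, ?_, ?_⟩
  · rw [hxe]
    refine norm_cfc_le zero_le_one fun t ht => ?_
    rw [Real.norm_eq_abs, abs_le]
    constructor <;> linarith [hK0 t ht, hKle t]
  · rw [hxe, ← cfc_mul H _ w]
    refine cfc_congr fun t ht => ?_
    rcases le_total 1 (2 * t / ε) with h1 | h1
    · simp [hK, h1]
    · have : 1 ≤ 3 - 4 * t / ε := by
        have : 4 * t / ε = 2 * (2 * t / ε) := by ring
        linarith
      simp [hH, this]
  · have e : (cfc H w + 1) * w = cfc (fun t => (H t + 1) * t) w := by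
      rw [cfc_mul (fun t => H t + 1) (fun t => t) w, cfc_add_const (1 : ℝ) H w, cfc_id' ℝ w,
        map_one]
    rw [e]
    refine norm_cfc_le (by positivity) fun t ht => ?_
    have ht0 := hsp t ht
    have hlo : -1 ≤ H t := hH t ▸ le_max_left _ _
    have hhi : H t ≤ 1 := hH t ▸ max_le (by norm_num) (min_le_left _ _)
    rw [norm_mul, Real.norm_of_nonneg ht0, Real.norm_of_nonneg (by linarith)]
    rcases le_total t ε with h1 | h1
    · nlinarith
    · have h2 : 3 - 4 * t / ε ≤ -1 := by
        have : 4 ≤ 4 * t / ε := by rw [le_div_iff₀ hε]; linarith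
        linarith
      have h3 : H t = -1 := (hH t).trans (max_eq_left ((min_le_right _ _).trans h2))
      rw [h3, neg_add_cancel, zero_mul]
      positivity
  · rw [← cfc_mul K K w, ← cfc_const_mul_id (2 / ε) w]
    refine cfc_mono fun t ht => ?_
    calc K t * K t ≤ K t := mul_le_of_le_one_left (hK0 t ht) (hKle t)
      _ ≤ 2 * t / ε := hK t ▸ min_le_right _ _
      _ = 2 / ε * t := by ring

/-- In real rank zero, a positive element in the kernel of a state can be made arbitrarily small
by a projection in the projection filter. -/
lemma exists_mem_projFilter_norm_mul_le (hrr : RealRankZero C) {φ : C →L[ℂ] ℂ} (hφ : IsState φ)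
    {w : C} (hw : 0 ≤ w) (hφw : φ w = 0) {ε : ℝ} (hε : 0 < ε) :
    ∃ p ∈ ProjFilter φ, ‖p * w‖ ≤ 3 * ε := by
  obtain ⟨h, k, hhs, hks, hxn, hhx, hhw, hkk⟩ := exists_cutoffs hw hε
  obtain ⟨x, hx⟩ : ∃ x, x = 1 - k := ⟨_, rfl⟩
  rw [← hx] at hxn hhx
  have hxs : IsSelfAdjoint x := hx ▸ (IsSelfAdjoint.one C).sub hks
  obtain ⟨η, hη0, hη1, hη2⟩ : ∃ η : ℝ, 0 < η ∧ η ≤ 1 / 60 ∧ 28 * η * ‖w‖ ≤ ε := by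
    refine ⟨min (1 / 60) (ε / (28 * (‖w‖ + 1))), by positivity, min_le_left _ _, ?_⟩
    have h1 := min_le_right (1 / 60 : ℝ) (ε / (28 * (‖w‖ + 1)))
    rw [le_div_iff₀ (by positivity)] at h1
    have : 0 < min (1 / 60 : ℝ) (ε / (28 * (‖w‖ + 1))) := by positivity
    nlinarith
  obtain ⟨b, hbs, hbu, hhb⟩ := hrr h hhs η hη0
  rw [norm_sub_rev] at hhb
  obtain ⟨p, hp, hp1, hp2⟩ := exists_isStarProjection_norm_mul_le hbs hbu
  have hP := hp.one_sub
  set P := 1 - p with hPdef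
  have hPx : ‖P * x‖ ≤ η := by
    refine (hp2 x).trans ?_
    have : (b - 1) * x = (b - h) * x := by rw [sub_mul, sub_mul, hhx, one_mul]
    rw [this]
    exact (norm_mul_le _ _).trans
      ((mul_le_of_le_one_right (norm_nonneg _) hxn).trans hhb.le)
  have hxP : ‖x * P‖ ≤ η := by
    rw [← norm_star, star_mul, hxs.star_eq, hP.isSelfAdjoint.star_eq]
    exact hPx
  have hpw : ‖p * w‖ ≤ η * ‖w‖ + 2 * ε := by
    refine (hp1 w).trans ?_
    have : (b + 1) * w = (b - h) * w + (h + 1) * w := by noncomm_ring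
    rw [this]
    refine (norm_add_le _ _).trans (add_le_add ((norm_mul_le _ _).trans ?_) hhw)
    gcongr
  set z := k * P * k with hzdef
  have hz : 0 ≤ z := hks.conjugate_nonneg hP.nonneg
  have hzP : ‖z - P‖ ≤ 3 * η := by
    have e : z - P = x * (P * x) - P * x - x * P := by
      rw [hzdef, hx]
      noncomm_ring
    have h1 : ‖x * (P * x)‖ ≤ η :=
      (norm_mul_le _ _).trans ((mul_le_of_le_one_left (norm_nonneg _) hxn).trans hPx)
    rw [e]
    linarith [norm_sub_le (x * (P * x) - P * x) (x * P), norm_sub_le (x * (P * x)) (P * x)]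
  obtain ⟨Q, hQ, hQP, hQz⟩ := exists_isStarProjection_le_two_smul hz hP (by linarith) hzP
  have hφz : φ z = 0 := by
    refine hφ.apply_eq_zero_of_le_smul (r := 2 / ε) hz ?_ hφw
    have h1 : z ≤ k * 1 * k := hks.conjugate_le_conjugate hP.le_one
    exact h1.trans (by rwa [mul_one])
  have hφQ : φ Q = 0 := hφ.apply_eq_zero_of_le_smul hQ.nonneg hQz hφz
  have hQ' := hQ.one_sub
  refine ⟨1 - Q, ⟨hQ'.isSelfAdjoint, hQ'.isIdempotentElem, ?_⟩, ?_⟩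
  · rw [map_sub, hφ.1, hφQ, sub_zero]
  · have e : (1 - Q) * w = p * w - (Q - P) * w := by
      rw [hPdef]
      noncomm_ring
    have h1 : ‖(Q - P) * w‖ ≤ 27 * η * ‖w‖ := by
      refine (norm_mul_le _ _).trans ?_
      gcongr
      linarith
    rw [e]
    linarith [norm_sub_le (p * w) ((Q - P) * w)]

/-- Let `C` be a unital C*-algebra of real rank zero and `φ` a state on `C`.
If the projection filter `P_φ` is a P-filter (every countable subset has a lower bound in
`P_φ` under `≤`), then the quantum filter `F_φ` is a P-filter under `≪`; in fact lower bounds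
can be chosen to be projections. -/
theorem quantumFilter_pFilter_of_projFilter_pFilter
    (hrr : RealRankZero C) (φ : C →L[ℂ] ℂ) (hstate : IsState φ)
    (hP : ∀ p : ℕ → C, (∀ n, p n ∈ ProjFilter φ) →
      ∃ q ∈ ProjFilter φ, ∀ n, q ≤ p n) :
    ∀ a : ℕ → C, (∀ n, a n ∈ QuantumFilter φ) →
      ∃ p ∈ ProjFilter φ, ∀ n, p * a n = p := by
  intro a ha
  have hw (n : ℕ) : 0 ≤ 1 - a n :=
    sub_nonneg.2 ((CStarAlgebra.norm_le_one_iff_of_nonneg (a n) (ha n).1).1 (ha n).2.1.le)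
  have hφw (n : ℕ) : φ (1 - a n) = 0 := by rw [map_sub, hstate.1, (ha n).2.2, sub_self]
  have hex (n m : ℕ) : ∃ p ∈ ProjFilter φ, ‖p * (1 - a n)‖ ≤ 3 * (1 / ((m : ℝ) + 1)) :=
    exists_mem_projFilter_norm_mul_le hrr hstate (hw n) (hφw n) Nat.one_div_pos_of_nat
  choose p hp hpn using hex
  obtain ⟨q, hq, hqp⟩ := hP (fun i => p i.unpair.1 i.unpair.2) fun i => hp _ _
  refine ⟨q, hq, fun n => ?_⟩
  have hqs : IsStarProjection q := ⟨hq.2.1, hq.1⟩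
  have hle (m : ℕ) : ‖q * (1 - a n)‖ ≤ 3 * (1 / ((m : ℝ) + 1)) := by
    have hps : IsStarProjection (p n m) := ⟨(hp n m).2.1, (hp n m).1⟩
    have h1 : q ≤ p n m := by simpa using hqp (Nat.pair n m)
    have h2 : q * p n m = q := (hqs.le_iff_mul_eq_left hps).1 h1
    rw [← h2, mul_assoc]
    exact (norm_mul_le _ _).trans
      ((mul_le_of_le_one_left (norm_nonneg _) hqs.norm_le_one).trans (hpn n m))
  have hlim : Filter.Tendsto (fun m : ℕ => 3 * (1 / ((m : ℝ) + 1))) Filter.atTop (nhds 0) := by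
    simpa using (tendsto_one_div_add_atTop_nhds_zero_nat (𝕜 := ℝ)).const_mul 3
  have h0 : q * (1 - a n) = 0 := norm_le_zero_iff.1 (ge_of_tendsto' hlim hle)
  rw [mul_sub, mul_one, sub_eq_zero] at h0
  exact h0.symm

end
end

section
/- Let C be a unital, countably degree-1 saturated C*-algebra and φ a pure state on C such that (C,φ) is countably degree-1 saturated. Then F_φ is a quantum P-point: for every sequence (a_n) in F_φ there exists b ∈ F_φ with b·a_n = b for all n. -/
open scoped ComplexOrder

noncomputable section

/-- `C` is countably degree-1 saturated: every satisfiable countable degree-1 type over `C`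
is realized. -/
def CountablyDeg1Saturated (C : Type*) [CStarAlgebra C] : Prop :=
  ∀ (P : ℕ → Deg1Poly C) (r : ℕ → ℝ), (∀ j, 0 ≤ r j) →
    (∀ (F : Finset ℕ) (ε : ℝ), 0 < ε →
      ∃ b : ℕ → C, ∀ j ∈ F, |‖(P j).eval b‖ - r j| < ε) →
    ∃ b : ℕ → C, ∀ j, ‖(P j).eval b‖ = r j

variable {C : Type*} [CStarAlgebra C] [PartialOrder C] [StarOrderedRing C]

/-- A pure state: an extreme point of the set of states. -/
def IsPureState (φ : C →L[ℂ] ℂ) : Prop :=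
  IsState φ ∧ ∀ ψ₁ ψ₂ : C →L[ℂ] ℂ, IsState ψ₁ → IsState ψ₂ →
    ∀ t : ℝ, 0 < t → t < 1 → (∀ a : C, φ a = t * ψ₁ a + (1 - t) * ψ₂ a) →
      ψ₁ = φ ∧ ψ₂ = φ

/-- A positive functional is Hermitian. -/
lemma IsState.map_star {φ : C →L[ℂ] ℂ} (hφ : IsState φ) (a : C) : φ (star a) = star (φ a) := by
  let f : C →ₚ[ℂ] ℂ := .mk₀ (φ : C →ₗ[ℂ] ℂ) hφ.2
  exact StarHomClass.map_star f a

/-- The equality case of the Cauchy–Schwarz inequality `|φ y|² ≤ φ (y* y)`. -/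
lemma IsState.one_le_map_star_mul_self {φ : C →L[ℂ] ℂ} (hφ : IsState φ) {y : C}
    (hy : φ y = 1) : 1 ≤ φ (star y * y) := by
  have h := hφ.2 _ (star_mul_self_nonneg (y - 1))
  have hs : φ (star y) = 1 := by rw [hφ.map_star, hy, star_one]
  have e : star (y - 1) * (y - 1) = star y * y - star y - y + 1 := by
    rw [star_sub, star_one]; noncomm_ring
  rw [e, map_add, map_sub, map_sub, hs, hy, hφ.1] at h
  simpa using h

lemma IsState.map_le_norm {φ : C →L[ℂ] ℂ} (hφ : IsState φ) {a : C} (ha : 0 ≤ a) :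
    φ a ≤ (‖a‖ : ℂ) := by
  have h := hφ.2 _ (sub_nonneg.2 (IsSelfAdjoint.of_nonneg ha).le_algebraMap_norm_self)
  have e : algebraMap ℝ C ‖a‖ = (‖a‖ : ℂ) • (1 : C) := by
    rw [Algebra.algebraMap_eq_smul_one]; simp
  rw [map_sub, e, map_smul, hφ.1] at h
  simpa using h

/-- A contraction at which a state takes the value `1` has norm exactly `1`. -/
lemma IsState.norm_eq_one {φ : C →L[ℂ] ℂ} (hφ : IsState φ) {y : C} (hy : φ y = 1)
    (hn : ‖y‖ ≤ 1) : ‖y‖ = 1 := by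
  have h := (hφ.one_le_map_star_mul_self hy).trans (hφ.map_le_norm (star_mul_self_nonneg y))
  rw [CStarRing.norm_star_mul_self] at h
  have h' : (1 : ℝ) ≤ ‖y‖ * ‖y‖ := by exact_mod_cast h
  nlinarith [norm_nonneg y]

/-- The absolute value squared of a contraction with `φ y = 1` lies in the quantum filter. -/
lemma IsState.star_mul_self_mem_quantumFilter {φ : C →L[ℂ] ℂ} (hφ : IsState φ) {y : C}
    (hy : φ y = 1) (hn : ‖y‖ ≤ 1) : star y * y ∈ QuantumFilter φ := by
  have h1 : ‖star y * y‖ = 1 := by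
    rw [CStarRing.norm_star_mul_self, hφ.norm_eq_one hy hn, one_mul]
  refine ⟨star_mul_self_nonneg y, h1, le_antisymm ?_ (hφ.one_le_map_star_mul_self hy)⟩
  simpa [h1] using hφ.map_le_norm (star_mul_self_nonneg y)

lemma IsState.pow_two_pow_mem_quantumFilter {φ : C →L[ℂ] ℂ} (hφ : IsState φ) {c : C}
    (hc : c ∈ QuantumFilter φ) (k : ℕ) : c ^ 2 ^ k ∈ QuantumFilter φ := by
  induction k with
  | zero => simpa using hc
  | succ k ih =>
    have h := hφ.star_mul_self_mem_quantumFilter ih.2.2 ih.2.1.le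
    rwa [(IsSelfAdjoint.of_nonneg ih.1).star_eq, ← sq, ← pow_mul, ← pow_succ] at h

lemma Real.pow_mul_one_sub_le {t : ℝ} (h0 : 0 ≤ t) (h1 : t ≤ 1) (k : ℕ) :
    t ^ k * (1 - t) ≤ 1 / (k + 1) := by
  rw [le_div_iff₀ (by positivity)]
  have h : (k + 1 : ℝ) * t ^ k ≤ ∑ i ∈ Finset.range (k + 1), t ^ i := by
    have := Finset.card_nsmul_le_sum (Finset.range (k + 1)) (fun i => t ^ i) (t ^ k)
      fun i hi => pow_le_pow_of_le_one h0 h1 (by simpa [Nat.lt_succ_iff] using hi)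
    simpa using this
  have hg := geom_sum_mul_neg t (k + 1)
  nlinarith [pow_nonneg h0 (k + 1)]

/-- Powers of a positive contraction `c` are asymptotically fixed by `c`. -/
lemma norm_pow_mul_one_sub_mul_pow_le {c : C} (h0 : 0 ≤ c) (h1 : ‖c‖ ≤ 1) (k : ℕ) :
    ‖c ^ k * (1 - c) * c ^ k‖ ≤ 1 / (k + 1) := by
  have hsa := IsSelfAdjoint.of_nonneg h0
  have e : c ^ k * (1 - c) * c ^ k = cfc (fun t : ℝ => t ^ k * (1 - t) * t ^ k) c := by
    rw [cfc_mul (fun t : ℝ => t ^ k * (1 - t)) (fun t => t ^ k) c,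
      cfc_mul (fun t : ℝ => t ^ k) (fun t => 1 - t) c,
      cfc_sub (fun _ : ℝ => 1) (fun t => t) c, cfc_pow_id c k, cfc_const_one ℝ c, cfc_id' ℝ c]
  rw [e]
  refine norm_cfc_le (by positivity) fun t ht => ?_
  have ht0 : 0 ≤ t := spectrum_nonneg_of_nonneg h0 ht
  have ht1 : t ≤ 1 := by
    have := (CStarAlgebra.norm_le_one_iff_of_nonneg c h0).1 h1
    exact (le_algebraMap_iff_spectrum_le (r := (1 : ℝ)) (a := c)).1 (by simpa using this) t ht
  have hp := pow_le_one₀ (n := k) ht0 ht1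
  have hq := Real.pow_mul_one_sub_le ht0 ht1 k
  have hr : 0 ≤ t ^ k * (1 - t) := mul_nonneg (pow_nonneg ht0 k) (by linarith)
  rw [Real.norm_of_nonneg (mul_nonneg hr (pow_nonneg ht0 k))]
  nlinarith

/-- Finitely many members of the quantum filter of a state have an approximate common lower
bound in the quantum filter. -/
lemma IsState.exists_norm_mul_sub_one_lt {φ : C →L[ℂ] ℂ} (hφ : IsState φ) {N : ℕ} {a : ℕ → C}
    (ha : ∀ n, a n ∈ QuantumFilter φ) {ε : ℝ} (hε : 0 < ε) :
    ∃ y ∈ QuantumFilter φ, ∀ i < N, ‖y * (a i - 1)‖ < ε := by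
  have hle (i) : a i ≤ 1 := (CStarAlgebra.norm_le_one_iff_of_nonneg _ (ha i).1).1 (ha i).2.1.le
  have hN : (0 : ℝ) < N + 1 := by positivity
  set d : C := ∑ i ∈ Finset.range (N + 1), (1 - a i) with hd
  set c : C := ((N : ℝ) + 1)⁻¹ • ∑ i ∈ Finset.range (N + 1), a i with hcdef
  have hdc : d = ((N : ℝ) + 1) • (1 - c) := by
    rw [smul_sub, hcdef, smul_inv_smul₀ hN.ne', hd, Finset.sum_sub_distrib]
    simp [add_smul, Nat.cast_smul_eq_nsmul]
  have hc0 : 0 ≤ c := smul_nonneg (by positivity) (Finset.sum_nonneg fun i _ => (ha i).1)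
  have hd0 : 0 ≤ d := Finset.sum_nonneg fun i _ => sub_nonneg.2 (hle i)
  have hc1 : c ≤ 1 := by
    have : 0 ≤ ((N : ℝ) + 1)⁻¹ • d := smul_nonneg (by positivity) hd0
    rwa [hdc, inv_smul_smul₀ hN.ne', sub_nonneg] at this
  have hcn : ‖c‖ ≤ 1 := (CStarAlgebra.norm_le_one_iff_of_nonneg _ hc0).2 hc1
  have hφc : φ c = 1 := by
    have e : c = (((N : ℂ) + 1)⁻¹) • ∑ i ∈ Finset.range (N + 1), a i := by
      rw [hcdef, ← Complex.coe_smul]; simp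
    rw [e, map_smul, map_sum, Finset.sum_congr rfl fun i _ => (ha i).2.2]
    have : (N : ℂ) + 1 ≠ 0 := by exact_mod_cast hN.ne'
    simp [this]
  have hcF : c ∈ QuantumFilter φ := ⟨hc0, hφ.norm_eq_one hφc hcn, hφc⟩
  obtain ⟨k, hk⟩ := exists_nat_gt ((N + 1) / ε ^ 2)
  have hyF := hφ.pow_two_pow_mem_quantumFilter hcF k
  set y := c ^ 2 ^ k with hy
  have hysa : star y = y := (IsSelfAdjoint.of_nonneg hyF.1).star_eq
  refine ⟨y, hyF, fun i hi => ?_⟩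
  have hb0 : 0 ≤ 1 - a i := sub_nonneg.2 (hle i)
  have hbb : (1 - a i) * (1 - a i) ≤ 1 - a i := by
    simpa [sq] using CStarAlgebra.pow_antitone hb0 (sub_le_self 1 (ha i).1) one_le_two
  have hbd : 1 - a i ≤ d :=
    Finset.single_le_sum (f := fun i => 1 - a i) (fun j _ => sub_nonneg.2 (hle j))
      (by simp; omega)
  have hsq : ‖y * (a i - 1)‖ ^ 2 = ‖y * ((1 - a i) * (1 - a i)) * y‖ := by
    have hs : star (y * (a i - 1)) = (a i - 1) * y := by
      rw [star_mul, hysa, star_sub, star_one, (IsSelfAdjoint.of_nonneg (ha i).1).star_eq]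
    rw [sq, ← CStarRing.norm_self_mul_star, hs]
    congr 1
    noncomm_ring
  have hle1 : y * ((1 - a i) * (1 - a i)) * y ≤ y * d * y :=
    conjugate_le_conjugate_of_nonneg (hbb.trans hbd) hyF.1
  have hb2 : 0 ≤ (1 - a i) * (1 - a i) := by
    simpa [(IsSelfAdjoint.of_nonneg hb0).star_eq] using star_mul_self_nonneg (1 - a i)
  have h0 : 0 ≤ y * ((1 - a i) * (1 - a i)) * y := conjugate_nonneg_of_nonneg hb2 hyF.1
  have hn := CStarAlgebra.norm_le_norm_of_nonneg_of_le h0 hle1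
  have hydy : ‖y * d * y‖ ≤ (N + 1) * (1 / ((2 ^ k : ℕ) + 1)) := by
    rw [hdc, mul_smul_comm, smul_mul_assoc, norm_smul, Real.norm_of_nonneg hN.le]
    gcongr
    exact norm_pow_mul_one_sub_mul_pow_le hc0 hcn _
  have hk2 : (k : ℝ) < ((2 ^ k : ℕ) : ℝ) + 1 := by
    have : k < 2 ^ k + 1 := k.lt_two_pow_self.trans (Nat.lt_succ_self _)
    exact_mod_cast this
  refine lt_of_pow_lt_pow_left₀ 2 hε.le ?_
  rw [hsq]
  refine (hn.trans hydy).trans_lt ?_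
  rw [mul_one_div, div_lt_iff₀ (by positivity), mul_comm]
  exact (div_lt_iff₀ (by positivity)).1 (hk.trans hk2)

/-- The degree-1 *-polynomial `x₀ * c`. -/
def Deg1Poly.mulRight {A : Type*} [Ring A] [StarRing A] (c : A) : Deg1Poly A where
  m := 1
  n := 1
  const := 0
  a1 _ _ := 1
  a2 _ _ := c
  a3 _ _ := 0
  a4 _ _ := 0

@[simp] lemma Deg1Poly.eval_mulRight {A : Type*} [Ring A] [StarRing A] (c : A) (x : ℕ → A) :
    (Deg1Poly.mulRight c).eval x = x 0 * c := by
  change (∑ _i : Fin 1, ∑ _j : Fin 1, (1 * x _ * c + 0 * star (x _) * 0)) + 0 = _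
  simp

/-- Let `C` be a unital, countably degree-1 saturated C*-algebra and `φ` a pure
state on `C` such that `(C, φ)` is countably degree-1 saturated.  Then `F_φ` is a quantum
P-point. -/
theorem quantumFilter_is_quantum_pPoint_of_pairSaturated
    (hCsat : CountablyDeg1Saturated C)
    (φ : C →L[ℂ] ℂ) (hpure : IsPureState φ)
    (hsat : PairCountablyDeg1Saturated φ) :
    ∀ a : ℕ → C, (∀ n, a n ∈ QuantumFilter φ) →
      ∃ b ∈ QuantumFilter φ, ∀ n, b * a n = b := by
  intro a ha
  have hφ := hpure.1
  let P : ℕ → Deg1Poly C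
    | 0 => .mulRight 1
    | 1 => .mulRight 1
    | n + 2 => .mulRight (a n - 1)
  let isNorm : ℕ → Bool
    | 0 => false
    | _ + 1 => true
  let s : ℕ → ℂ
    | 0 => 1
    | 1 => 1
    | _ + 2 => 0
  obtain ⟨x, hx⟩ := hsat P isNorm s fun F ε hε => by
    obtain ⟨y, hy, hya⟩ := hφ.exists_norm_mul_sub_one_lt (N := F.sup id) ha hε
    refine ⟨fun _ => y, fun j hj => ?_⟩
    have hjF : j ≤ F.sup id := Finset.le_sup (f := id) hj
    match j with
    | 0 => simpa [P, isNorm, s, hy.2.2] using hε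
    | 1 => simpa [P, isNorm, s, hy.2.1] using hε
    | n + 2 => simpa [P, isNorm, s] using hya n (by omega)
  have h0 : φ (x 0) = 1 := by simpa [P, isNorm, s] using hx 0
  have h1 : ‖x 0‖ = 1 := by
    have := hx 1
    simp only [P, isNorm, s, Deg1Poly.eval_mulRight, mul_one, if_true] at this
    exact_mod_cast this
  refine ⟨star (x 0) * x 0, hφ.star_mul_self_mem_quantumFilter h0 h1.le, fun n => ?_⟩
  have h2 : x 0 * (a n - 1) = 0 := by simpa [P, isNorm, s] using hx (n + 2)
  rw [mul_sub, mul_one, sub_eq_zero] at h2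
  rw [mul_assoc, h2]

end
end

section
/- Let C be a unital, countably degree-1 saturated C*-algebra and φ a pure state on C such that F_φ is a quantum P-point (for every sequence (a_n) in F_φ there exists b ∈ F_φ with b·a_n = b for all n). Then (C,φ) is countably degree-1 saturated. -/
open scoped ComplexOrder

noncomputable section

variable {C : Type*} [CStarAlgebra C] [PartialOrder C] [StarOrderedRing C]

set_option linter.unusedSectionVars false

open ComplexStarModule

lemma IsState.re_nonneg {φ : C →L[ℂ] ℂ} (hφ : IsState φ) {a : C} (ha : 0 ≤ a) :
    0 ≤ (φ a).re := (Complex.le_def.1 (hφ.2 a ha)).1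

lemma IsState.im_eq_zero {φ : C →L[ℂ] ℂ} (hφ : IsState φ) {a : C} (ha : 0 ≤ a) :
    (φ a).im = 0 := (Complex.le_def.1 (hφ.2 a ha)).2.symm

lemma IsState.re_mono {φ : C →L[ℂ] ℂ} (hφ : IsState φ) {a b : C} (hab : a ≤ b) :
    (φ a).re ≤ (φ b).re := by
  have := hφ.re_nonneg (sub_nonneg.2 hab)
  simpa using this

lemma IsState.map_real_smul_one {φ : C →L[ℂ] ℂ} (hφ : IsState φ) (r : ℝ) :
    φ (r • 1) = r := by
  rw [← Complex.coe_smul, map_smul, hφ.1]; simp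

lemma IsSelfAdjoint.le_norm_smul_one {a : C} (ha : IsSelfAdjoint a) : a ≤ ‖a‖ • (1 : C) := by
  rw [← Algebra.algebraMap_eq_smul_one]; exact ha.le_algebraMap_norm_self

lemma IsState.im_eq_zero_of_isSelfAdjoint {φ : C →L[ℂ] ℂ} (hφ : IsState φ) {a : C}
    (ha : IsSelfAdjoint a) : (φ a).im = 0 := by
  have h := hφ.im_eq_zero (sub_nonneg.2 ha.le_norm_smul_one)
  rw [map_sub, hφ.map_real_smul_one] at h
  simpa using h

/-- The Minkowski-type gauge `x ↦ inf {φ h : h ≥ 0, h ≥ Re x}`. -/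
def dominationGauge (φ : C →L[ℂ] ℂ) (x : C) : ℝ :=
  sInf ((fun h : C => (φ h).re) '' {h | 0 ≤ h ∧ (ℜ x : C) ≤ h})

lemma dominationGauge_le {φ : C →L[ℂ] ℂ} (hφ : IsState φ) {x h : C} (h0 : 0 ≤ h)
    (hx : (ℜ x : C) ≤ h) : dominationGauge φ x ≤ (φ h).re := by
  refine csInf_le ⟨0, ?_⟩ ⟨h, ⟨h0, hx⟩, rfl⟩
  rintro _ ⟨k, ⟨hk, -⟩, rfl⟩
  exact hφ.re_nonneg hk

lemma le_dominationGauge {φ : C →L[ℂ] ℂ} {x : C} {t : ℝ}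
    (H : ∀ h : C, 0 ≤ h → (ℜ x : C) ≤ h → t ≤ (φ h).re) : t ≤ dominationGauge φ x := by
  refine le_csInf ⟨_, ‖(ℜ x : C)‖ • 1, ⟨smul_nonneg (norm_nonneg _) zero_le_one, ?_⟩, rfl⟩ ?_
  · exact (ℜ x).2.le_norm_smul_one
  · rintro _ ⟨k, ⟨hk, hk'⟩, rfl⟩
    exact H k hk hk'

lemma dominationGauge_nonneg {φ : C →L[ℂ] ℂ} (hφ : IsState φ) (x : C) :
    0 ≤ dominationGauge φ x := le_dominationGauge fun _ h _ => hφ.re_nonneg h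

lemma dominationGauge_le_zero {φ : C →L[ℂ] ℂ} (hφ : IsState φ) {x : C} (hx : (ℜ x : C) ≤ 0) :
    dominationGauge φ x ≤ 0 := by
  simpa using dominationGauge_le hφ le_rfl hx

lemma dominationGauge_le_norm {φ : C →L[ℂ] ℂ} (hφ : IsState φ) (x : C) :
    dominationGauge φ x ≤ ‖x‖ := by
  have h : (ℜ x : C) ≤ ‖x‖ • (1 : C) :=
    (ℜ x).2.le_norm_smul_one.trans (smul_le_smul_of_nonneg_right (realPart.norm_le x) zero_le_one)
  have := dominationGauge_le hφ (smul_nonneg (norm_nonneg x) zero_le_one) h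
  rwa [hφ.map_real_smul_one, Complex.ofReal_re] at this

lemma dominationGauge_add {φ : C →L[ℂ] ℂ} (hφ : IsState φ) (x y : C) :
    dominationGauge φ (x + y) ≤ dominationGauge φ x + dominationGauge φ y := by
  rw [← sub_le_iff_le_add]
  refine le_dominationGauge fun h h0 hh => ?_
  rw [sub_le_comm]
  refine le_dominationGauge fun k k0 hk => ?_
  have := dominationGauge_le hφ (x := x + y) (add_nonneg h0 k0) (by
    rw [map_add]; exact add_le_add hh hk)
  rw [map_add, Complex.add_re] at this
  linarith

lemma dominationGauge_smul_le {φ : C →L[ℂ] ℂ} (hφ : IsState φ) {c : ℝ} (hc : 0 < c) (x : C) :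
    dominationGauge φ (c • x) ≤ c * dominationGauge φ x := by
  rw [← div_le_iff₀' hc]
  refine le_dominationGauge fun h h0 hh => ?_
  rw [div_le_iff₀' hc]
  have := dominationGauge_le hφ (x := c • x) (smul_nonneg hc.le h0) (by
    rw [map_smul]; exact smul_le_smul_of_nonneg_left hh hc.le)
  have e : φ (c • h) = c * φ h := by rw [← Complex.coe_smul, map_smul, smul_eq_mul]
  rwa [e, Complex.re_ofReal_mul] at this

lemma dominationGauge_smul {φ : C →L[ℂ] ℂ} (hφ : IsState φ) {c : ℝ} (hc : 0 < c) (x : C) :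
    dominationGauge φ (c • x) = c * dominationGauge φ x := by
  refine (dominationGauge_smul_le hφ hc x).antisymm ?_
  have := dominationGauge_smul_le hφ (inv_pos.2 hc) (c • x)
  rwa [inv_smul_smul₀ hc.ne', ← div_eq_inv_mul, le_div_iff₀' hc] at this

/-- A functional between `0` and a pure state is a scalar multiple of that state. -/
lemma IsPureState.eq_smul_of_le {φ : C →L[ℂ] ℂ} (hφ : IsPureState φ) (g : C →L[ℂ] ℂ)
    (g0 : ∀ a : C, 0 ≤ a → 0 ≤ g a) (g1 : ∀ a : C, 0 ≤ a → g a ≤ φ a) :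
    ∃ c : ℂ, ∀ a, g a = c * φ a := by
  have hφ1 := hφ.1.1
  obtain ⟨t, ht⟩ : ∃ t : ℝ, g 1 = t :=
    ⟨(g 1).re, Complex.ext rfl (Complex.le_def.1 (g0 1 zero_le_one)).2.symm⟩
  have ht0 : 0 ≤ t := by simpa [ht] using g0 1 zero_le_one
  have ht1 : t ≤ 1 := by
    have := g1 1 zero_le_one
    rw [ht, hφ1] at this
    exact_mod_cast this
  set s : ℝ := (t + 1) / 3 with hs
  have hs0 : 0 < s := by positivity
  have hs1 : 0 < 1 - s := by linarith
  have hsC : (s : ℂ) ≠ 0 := by exact_mod_cast hs0.ne'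
  have hsC1 : ((1 - s : ℝ) : ℂ) ≠ 0 := by exact_mod_cast hs1.ne'
  have st1 : IsState (((s⁻¹ * 3⁻¹ : ℝ) : ℂ) • (g + φ)) := by
    refine ⟨?_, fun a ha => ?_⟩
    · simp only [smul_apply, add_apply, smul_eq_mul, ht, hφ1]
      norm_cast
      rw [hs] at hs0 ⊢
      field_simp
    · exact mul_nonneg (by norm_cast; positivity) (add_nonneg (g0 a ha) (hφ.1.2 a ha))
  have st2 : IsState ((((1 - s)⁻¹ * 3⁻¹ : ℝ) : ℂ) • (φ + (φ - g))) := by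
    refine ⟨?_, fun a ha => ?_⟩
    · simp only [smul_apply, add_apply, sub_apply, smul_eq_mul, ht, hφ1]
      norm_cast
      field_simp
      rw [hs]
      ring
    · exact mul_nonneg (by norm_cast; positivity)
        (add_nonneg (hφ.1.2 a ha) (sub_nonneg.2 (g1 a ha)))
  obtain ⟨h, -⟩ := hφ.2 _ _ st1 st2 s hs0 (by linarith) (fun a => by
    simp only [smul_apply, add_apply, sub_apply, smul_eq_mul]
    push_cast at hsC1 ⊢
    field_simp
    ring)
  refine ⟨3 * s - 1, fun a => ?_⟩
  have := DFunLike.congr_fun h a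
  simp only [smul_apply, add_apply, smul_eq_mul, Complex.ofReal_mul, Complex.ofReal_inv] at this
  field_simp at this
  push_cast at this
  linear_combination this

/-- If `φ` is pure, every self-adjoint element of its kernel is dominated by positive elements on
which `φ` is arbitrarily small. -/
lemma IsPureState.exists_nonneg_ge {φ : C →L[ℂ] ℂ} (hφ : IsPureState φ) {a : C}
    (ha : IsSelfAdjoint a) (h0 : φ a = 0) {ε : ℝ} (hε : 0 < ε) :
    ∃ h : C, 0 ≤ h ∧ a ≤ h ∧ (φ h).re ≤ ε := by
  by_contra! H
  have hre : (ℜ a : C) = a := ha.coe_realPart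
  have hN : ε ≤ dominationGauge φ a :=
    le_dominationGauge fun h h1 h2 => (H h h1 (hre ▸ h2)).le
  have ha0 : a ≠ 0 := by
    rintro rfl
    exact absurd (dominationGauge_le_zero hφ.1 hre.le) (by linarith)
  obtain ⟨ρ, hρa, hρ⟩ := exists_extension_of_le_sublinear
    (LinearPMap.mkSpanSingleton a (dominationGauge φ a) ha0) (dominationGauge φ)
    (fun c hc x => dominationGauge_smul hφ.1 hc x) (dominationGauge_add hφ.1) (by
      rintro ⟨x, hx⟩
      obtain ⟨c, rfl⟩ := Submodule.mem_span_singleton.1 hx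
      have e : LinearPMap.mkSpanSingleton (σ := RingHom.id ℝ) a (dominationGauge φ a) ha0
          ⟨c • a, hx⟩ = c * dominationGauge φ a := LinearPMap.mkSpanSingleton'_apply _ _ _ c _
      rw [e]
      rcases le_or_gt c 0 with hc | hc
      · exact (mul_nonpos_of_nonpos_of_nonneg hc (hε.le.trans hN)).trans
          (dominationGauge_nonneg hφ.1 _)
      · exact (dominationGauge_smul hφ.1 hc a).ge)
  have hρa : ρ a = dominationGauge φ a := by
    have := hρa ⟨a, Submodule.mem_span_singleton_self a⟩
    rw [this]
    exact LinearPMap.mkSpanSingleton_apply ℝ ℝ ha0 _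
  have hρ0 : ∀ x : C, (ℜ x : C) ≤ 0 → ρ x ≤ 0 := fun x hx =>
    (hρ x).trans (dominationGauge_le_zero hφ.1 hx)
  let r : StrongDual ℝ C := ρ.mkContinuous 1 fun x => by
    rw [one_mul, Real.norm_eq_abs, abs_le']
    refine ⟨(hρ x).trans (dominationGauge_le_norm hφ.1 x), ?_⟩
    rw [← map_neg, ← norm_neg x]
    exact (hρ _).trans (dominationGauge_le_norm hφ.1 _)
  let g : C →L[ℂ] ℂ := r.extendRCLike
  have hgre : ∀ x, (g x).re = ρ x := fun x => StrongDual.re_extendRCLike_apply (𝕜 := ℂ) r x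
  have hgim : ∀ x : C, 0 ≤ x → (g x).im = 0 := fun x hx => by
    have h1 : (g x).im = - ρ (Complex.I • x) := StrongDual.im_extendRCLike_apply (𝕜 := ℂ) r x
    have h2 : ℜ (Complex.I • x) = 0 := by
      rw [realPart_I_smul, (IsSelfAdjoint.of_nonneg hx).imaginaryPart, neg_zero]
    have h3 := hρ0 (Complex.I • x) (by rw [h2]; simp)
    have h4 := hρ0 (-(Complex.I • x)) (by rw [map_neg, h2]; simp)
    rw [map_neg] at h4
    linarith
  obtain ⟨c, hc⟩ := hφ.eq_smul_of_le g (fun x hx => by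
      refine Complex.le_def.2 ⟨?_, (hgim x hx).symm⟩
      have := hρ0 (-x) (by
        rw [(IsSelfAdjoint.of_nonneg hx).neg.coe_realPart]
        exact neg_nonpos.2 hx)
      rw [map_neg] at this
      rw [hgre, Complex.zero_re]
      linarith) (fun x hx => by
      refine Complex.le_def.2 ⟨?_, (hgim x hx).trans (hφ.1.im_eq_zero hx).symm⟩
      rw [hgre]
      exact (hρ x).trans
        (dominationGauge_le hφ.1 hx (IsSelfAdjoint.of_nonneg hx).coe_realPart.le))
  have : ρ a = 0 := by rw [← hgre, hc, h0]; simp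
  linarith

/-- A nonnegative `h` has a positive contractive resolvent `(1 + h)⁻¹`. -/
lemma exists_inverse_one_add {h : C} (hh : 0 ≤ h) :
    ∃ f : C, 0 ≤ f ∧ f ≤ 1 ∧ f * h = 1 - f ∧ h * f = 1 - f := by
  have h1 : (1 : C) ≤ 1 + h := le_add_of_nonneg_right hh
  obtain ⟨u, hu⟩ := CStarAlgebra.isUnit_of_le (1 : C) h1
  have e1 : (↑u⁻¹ : C) * (1 + h) = 1 := by rw [← hu, Units.inv_mul]
  have e2 : (1 + h) * (↑u⁻¹ : C) = 1 := by rw [← hu, Units.mul_inv]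
  have hsa : star (1 + h) = 1 + h := (IsSelfAdjoint.of_nonneg (zero_le_one.trans h1)).star_eq
  have hs : star (↑u⁻¹ : C) = ↑u⁻¹ := by
    rw [← Units.coe_star, star_inv]
    congr 2
    exact Units.ext (by rw [Units.coe_star, hu, hsa])
  refine ⟨↑u⁻¹, ?_, CStarAlgebra.inv_le_one (Units.val_le_val.1 (by rwa [hu])), ?_, ?_⟩
  · have := star_left_conjugate_nonneg (zero_le_one.trans h1) (↑u⁻¹ : C)
    rwa [hs, e1, one_mul] at this
  · rw [← e1]; noncomm_ring
  · rw [← e2]; noncomm_ring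

/-- Every vector of the GNS space of a pure state is approximated by a vector represented by an
element of comparable norm. -/
lemma IsPureState.exists_norm_sq_le {φ : C →L[ℂ] ℂ} (hφ : IsPureState φ) {c : C} {r : ℝ}
    (hr : 0 < r) (hc : (φ (star c * c)).re ≤ r) :
    ∃ d : C, ‖d‖ ^ 2 ≤ r ∧ (φ (star (c - d) * (c - d))).re ≤ r / 4 := by
  obtain ⟨s, hs⟩ : ∃ s : ℝ, φ (star c * c) = s :=
    ⟨_, Complex.ext rfl (hφ.1.im_eq_zero (star_mul_self_nonneg c))⟩
  obtain ⟨h, h0, hch, hφh⟩ := hφ.exists_nonneg_ge (a := star c * c - s • 1)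
    ((IsSelfAdjoint.star_mul_self c).sub ((IsSelfAdjoint.all s).smul (IsSelfAdjoint.one C)))
    (by rw [map_sub, hφ.1.map_real_smul_one, hs, sub_self]) (by positivity : 0 < r / 4)
  have hsr : s ≤ r := by simpa [hs] using hc
  have hle : star c * c ≤ r • (1 + r⁻¹ • h) := by
    rw [smul_add, smul_inv_smul₀ hr.ne']
    rw [sub_le_iff_le_add'] at hch
    exact hch.trans (by gcongr)
  obtain ⟨f, f0, f1, e1, e2⟩ := exists_inverse_one_add (smul_nonneg (inv_nonneg.2 hr.le) h0)
  have hf : star f = f := (IsSelfAdjoint.of_nonneg f0).star_eq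
  refine ⟨c * f, ?_, ?_⟩
  · have h1 := star_left_conjugate_le_conjugate hle f
    have h2 : star f * (r • (1 + r⁻¹ • h)) * f = r • f := by
      rw [mul_smul_comm, smul_mul_assoc, hf, mul_add, e1]; simp
    have h3 : star (c * f) * (c * f) ≤ r • 1 := by
      rw [star_mul]
      calc star f * star c * (c * f) = star f * (star c * c) * f := by noncomm_ring
        _ ≤ r • f := h1.trans h2.le
        _ ≤ r • 1 := smul_le_smul_of_nonneg_left f1 hr.le
    rw [sq, ← CStarRing.norm_star_mul_self,
      CStarAlgebra.norm_le_iff_le_algebraMap _ hr.le (star_mul_self_nonneg _),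
      Algebra.algebraMap_eq_smul_one]
    exact h3
  · have h1 := star_left_conjugate_le_conjugate hle (1 - f)
    have h2 : star (1 - f) * (r • (1 + r⁻¹ • h)) * (1 - f) = h - r • (1 - f) := by
      rw [star_sub, star_one, hf]
      have : (1 - f) * (1 + r⁻¹ • h) * (1 - f) = r⁻¹ • h - (1 - f) := by
        have e3 : (1 - f) * (1 + r⁻¹ • h) = r⁻¹ • h := by
          rw [sub_mul, one_mul, mul_add f, e1, mul_one]; abel
        rw [e3, mul_sub, e2, mul_one]
      rw [mul_smul_comm, smul_mul_assoc, this, smul_sub, smul_inv_smul₀ hr.ne']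
    have h3 : star (c - c * f) * (c - c * f) ≤ h :=
      calc star (c - c * f) * (c - c * f) = star (1 - f) * (star c * c) * (1 - f) := by
            rw [star_sub, star_sub, star_mul, star_one]; noncomm_ring
        _ ≤ h - r • (1 - f) := h1.trans h2.le
        _ ≤ h := sub_le_self _ (smul_nonneg hr.le (sub_nonneg.2 f1))
    exact (hφ.1.re_mono h3).trans hφh

/-- For a pure state `φ`, the distance from `c` to the left kernel of `φ` is controlled by the GNS
seminorm of `c`. -/
lemma IsPureState.exists_mem_leftKernel {φ : C →L[ℂ] ℂ} (hφ : IsPureState φ) {c : C} {r : ℝ}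
    (hr : 0 < r) (hc : (φ (star c * c)).re ≤ r) :
    ∃ l : C, φ (star l * l) = 0 ∧ ‖c - l‖ ≤ 2 * √r := by
  have H : ∀ (x : C) (n : ℕ), ∃ d : C, (φ (star x * x)).re ≤ r / 4 ^ n →
      ‖d‖ ^ 2 ≤ r / 4 ^ n ∧ (φ (star (x - d) * (x - d))).re ≤ r / 4 ^ n / 4 := fun x n => by
    by_cases hx : (φ (star x * x)).re ≤ r / 4 ^ n
    · obtain ⟨d, hd⟩ := hφ.exists_norm_sq_le (by positivity) hx
      exact ⟨d, fun _ => hd⟩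
    · exact ⟨0, fun h => absurd h hx⟩
  choose d hd using H
  let u : ℕ → C := fun n => Nat.rec c (fun n x => x - d x n) n
  have hu : ∀ n, (φ (star (u n) * u n)).re ≤ r / 4 ^ n := fun n => by
    induction n with
    | zero => rw [pow_zero, div_one]; exact hc
    | succ n ih => rw [pow_succ, ← div_div]; exact (hd _ n ih).2
  have hdist : ∀ n, dist (u n) (u (n + 1)) ≤ √r * (1 / 2) ^ n := fun n => by
    have h1 : dist (u n) (u (n + 1)) = ‖d (u n) n‖ := by
      rw [dist_eq_norm]; exact congrArg _ (sub_sub_cancel _ _)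
    rw [h1]
    refine abs_le_of_sq_le_sq' ?_ (by positivity) |>.2
    rw [mul_pow, Real.sq_sqrt hr.le, ← pow_mul, mul_comm n, pow_mul]
    refine (hd _ n (hu n)).1.trans (le_of_eq ?_)
    rw [div_eq_mul_inv, ← inv_pow]
    norm_num
  obtain ⟨l, hl⟩ := cauchySeq_tendsto_of_complete
    (cauchySeq_of_le_geometric (1 / 2) (√r) (by norm_num) hdist)
  refine ⟨l, ?_, ?_⟩
  · have h1 : Filter.Tendsto (fun n => (φ (star (u n) * u n)).re) Filter.atTop
        (nhds (φ (star l * l)).re) :=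
      ((Complex.continuous_re.comp φ.continuous).tendsto _).comp (hl.star.mul hl)
    have h2 : Filter.Tendsto (fun n : ℕ => r / 4 ^ n) Filter.atTop (nhds 0) :=
      tendsto_const_nhds.div_atTop (tendsto_pow_atTop_atTop_of_one_lt (by norm_num))
    refine Complex.ext (le_antisymm (le_of_tendsto_of_tendsto' h1 h2 hu) ?_)
      (hφ.1.im_eq_zero (star_mul_self_nonneg l))
    exact hφ.1.re_nonneg (star_mul_self_nonneg l)
  · have := dist_le_of_le_geometric_of_tendsto₀ (1 / 2) (√r) (by norm_num) hdist hl
    rw [dist_eq_norm] at this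
    refine this.trans (le_of_eq ?_)
    ring

lemma IsState.mem_quantumFilter {φ : C →L[ℂ] ℂ} (hφ : IsState φ) {f : C} (f0 : 0 ≤ f)
    (f1 : f ≤ 1) (h : φ f = 1) : f ∈ QuantumFilter φ := by
  refine ⟨f0, le_antisymm ((CStarAlgebra.norm_le_one_iff_of_nonneg f f0).2 f1) ?_, h⟩
  have := dominationGauge_le_norm hφ f
  refine le_trans (le_dominationGauge fun k _ hk => ?_) this
  rw [(IsSelfAdjoint.of_nonneg f0).coe_realPart] at hk
  simpa [h] using hφ.re_mono hk

/-- Elements of the left kernel of a state are small under some element of its quantum filter. -/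
lemma IsState.exists_mem_quantumFilter_norm_mul_le {φ : C →L[ℂ] ℂ} (hφ : IsState φ) {l : C}
    (hl : φ (star l * l) = 0) {δ : ℝ} (hδ : 0 < δ) :
    ∃ f ∈ QuantumFilter φ, ‖l * f‖ ≤ δ := by
  have hh : 0 ≤ (δ ^ 2)⁻¹ • (star l * l) := smul_nonneg (by positivity) (star_mul_self_nonneg l)
  obtain ⟨f, f0, f1, e1, e2⟩ := exists_inverse_one_add hh
  have hf : star f = f := (IsSelfAdjoint.of_nonneg f0).star_eq
  have hφh : φ ((δ ^ 2)⁻¹ • (star l * l)) = 0 := by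
    rw [← Complex.coe_smul, map_smul, hl, smul_zero]
  refine ⟨f, hφ.mem_quantumFilter f0 f1 ?_, ?_⟩
  · have h1 : 1 - f ≤ (δ ^ 2)⁻¹ • (star l * l) := by
      have h2 := star_left_conjugate_nonneg f0 ((δ ^ 2)⁻¹ • (star l * l))
      rw [(IsSelfAdjoint.of_nonneg hh).star_eq, e2, sub_mul, one_mul, e1] at h2
      exact sub_nonneg.1 h2
    have h3 := hφ.re_mono h1
    have h4 := hφ.re_nonneg (sub_nonneg.2 f1)
    have h5 := hφ.im_eq_zero (sub_nonneg.2 f1)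
    rw [hφh, Complex.zero_re] at h3
    have h6 : φ (1 - f) = 0 := Complex.ext (le_antisymm h3 h4) h5
    rw [map_sub, hφ.1, sub_eq_zero] at h6
    exact h6.symm
  · have h1 : star (l * f) * (l * f) ≤ (δ ^ 2) • 1 := by
      have : star (l * f) * (l * f) = δ ^ 2 • (f - f * f) := by
        calc star (l * f) * (l * f) = f * (star l * l) * f := by
              rw [star_mul, hf]; noncomm_ring
          _ = δ ^ 2 • (f * ((δ ^ 2)⁻¹ • (star l * l)) * f) := by
              rw [mul_smul_comm, smul_mul_assoc, smul_inv_smul₀ (by positivity)]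
          _ = δ ^ 2 • (f - f * f) := by rw [e1, sub_mul, one_mul]
      rw [this]
      refine smul_le_smul_of_nonneg_left ((sub_le_self _ ?_).trans f1) (by positivity)
      have := star_mul_self_nonneg f
      rwa [hf] at this
    refine abs_le_of_sq_le_sq' ?_ hδ.le |>.2
    rw [sq ‖_‖, ← CStarRing.norm_star_mul_self,
      CStarAlgebra.norm_le_iff_le_algebraMap _ (by positivity) (star_mul_self_nonneg _),
      Algebra.algebraMap_eq_smul_one]
    exact h1

/-- Excision of a pure state on a self-adjoint element of its kernel. -/
lemma IsPureState.exists_mem_quantumFilter_norm_le {φ : C →L[ℂ] ℂ} (hφ : IsPureState φ) {a : C}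
    (ha : IsSelfAdjoint a) (h0 : φ a = 0) {ε : ℝ} (hε : 0 < ε) :
    ∃ f ∈ QuantumFilter φ, ‖f * a * f‖ ≤ ε := by
  have hr : 0 < ε / 18 := by positivity
  obtain ⟨h, h0', hah, hφh⟩ := hφ.exists_nonneg_ge ha h0 (half_pos hr)
  have hk : 0 ≤ h - a := sub_nonneg.2 hah
  have hs : 0 ≤ h + (h - a) := add_nonneg h0' hk
  obtain ⟨c, hc⟩ := CStarAlgebra.nonneg_iff_eq_star_mul_self.1 hs
  have hφc : (φ (star c * c)).re ≤ ε / 18 := by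
    rw [← hc, map_add, map_sub, h0, sub_zero, Complex.add_re]; linarith
  obtain ⟨l, hl, hcl⟩ := hφ.exists_mem_leftKernel hr hφc
  obtain ⟨f, hf, hlf⟩ := hφ.1.exists_mem_quantumFilter_norm_mul_le hl (Real.sqrt_pos.2 hr)
  refine ⟨f, hf, ?_⟩
  have hfs : star f = f := (IsSelfAdjoint.of_nonneg hf.1).star_eq
  have hcf : ‖c * f‖ ≤ 3 * √(ε / 18) :=
    calc ‖c * f‖ = ‖(c - l) * f + l * f‖ := by rw [← add_mul, sub_add_cancel]
      _ ≤ ‖c - l‖ * ‖f‖ + ‖l * f‖ := (norm_add_le _ _).trans (by gcongr; exact norm_mul_le _ _)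
      _ ≤ 2 * √(ε / 18) * 1 + √(ε / 18) := by rw [hf.2.1]; gcongr
      _ = 3 * √(ε / 18) := by ring
  have hfsf : ‖f * (h + (h - a)) * f‖ ≤ ε / 2 :=
    calc ‖f * (h + (h - a)) * f‖ = ‖c * f‖ ^ 2 := by
          rw [sq, ← CStarRing.norm_star_mul_self, hc, star_mul, hfs]
          congr 1; noncomm_ring
      _ ≤ (3 * √(ε / 18)) ^ 2 := by gcongr
      _ = ε / 2 := by rw [mul_pow, Real.sq_sqrt hr.le]; ring
  have key : ∀ x : C, 0 ≤ x → x ≤ h + (h - a) → ‖f * x * f‖ ≤ ε / 2 := fun x hx hxs =>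
    (CStarAlgebra.norm_le_norm_of_nonneg_of_le (conjugate_nonneg_of_nonneg hx hf.1)
      (conjugate_le_conjugate_of_nonneg hxs hf.1)).trans hfsf
  calc ‖f * a * f‖ = ‖f * h * f - f * (h - a) * f‖ := by congr 1; noncomm_ring
    _ ≤ ‖f * h * f‖ + ‖f * (h - a) * f‖ := norm_sub_le _ _
    _ ≤ ε / 2 + ε / 2 := add_le_add (key _ h0' (le_add_of_nonneg_right hk))
        (key _ hk (le_add_of_nonneg_left h0'))
    _ = ε := add_halves ε

/-- `F_φ` is a quantum P-point. -/
def IsQuantumPPoint (φ : C →L[ℂ] ℂ) : Prop :=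
  ∀ a : ℕ → C, (∀ n, a n ∈ QuantumFilter φ) → ∃ b ∈ QuantumFilter φ, ∀ n, b * a n = b

lemma IsQuantumPPoint.exists_of_countable {φ : C →L[ℂ] ℂ} (hpp : IsQuantumPPoint φ)
    {ι : Type*} [Countable ι] [Nonempty ι] {a : ι → C} (ha : ∀ i, a i ∈ QuantumFilter φ) :
    ∃ b ∈ QuantumFilter φ, ∀ i, b * a i = b := by
  obtain ⟨e, he⟩ := exists_surjective_nat ι
  obtain ⟨b, hb, h⟩ := hpp (fun n => a (e n)) fun n => ha _
  exact ⟨b, hb, fun i => by obtain ⟨n, rfl⟩ := he i; exact h n⟩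

lemma QuantumFilter.star_eq {φ : C →L[ℂ] ℂ} {b : C} (hb : b ∈ QuantumFilter φ) : star b = b :=
  (IsSelfAdjoint.of_nonneg hb.1).star_eq

lemma QuantumFilter.mul_eq_of_mul_eq {φ : C →L[ℂ] ℂ} {b f : C} (hb : b ∈ QuantumFilter φ)
    (hf : f ∈ QuantumFilter φ) (h : b * f = b) : f * b = b := by
  have := congrArg star h
  rwa [star_mul, QuantumFilter.star_eq hb, QuantumFilter.star_eq hf] at this

/-- Exact simultaneous excision of countably many self-adjoint elements of the kernel. -/
lemma IsPureState.exists_mul_mul_eq_zero {φ : C →L[ℂ] ℂ} (hφ : IsPureState φ)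
    (hpp : IsQuantumPPoint φ) {ι : Type*} [Countable ι] [Nonempty ι] {a : ι → C}
    (ha : ∀ i, IsSelfAdjoint (a i)) (h0 : ∀ i, φ (a i) = 0) :
    ∃ b ∈ QuantumFilter φ, ∀ i, b * a i * b = 0 := by
  choose f hf hfa using fun (p : ι × ℕ) =>
    hφ.exists_mem_quantumFilter_norm_le (ha p.1) (h0 p.1) (ε := 1 / ((p.2 : ℝ) + 1))
      (by positivity)
  obtain ⟨b, hb, hbf⟩ := hpp.exists_of_countable hf
  refine ⟨b, hb, fun i => norm_le_zero_iff.1 ?_⟩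
  refine ge_of_tendsto' tendsto_one_div_add_atTop_nhds_zero_nat fun n => ?_
  have h1 := hbf (i, n)
  have h2 := QuantumFilter.mul_eq_of_mul_eq hb (hf _) h1
  calc ‖b * a i * b‖ = ‖b * (f (i, n) * a i * f (i, n)) * b‖ := by
        congr 1
        calc b * a i * b = (b * f (i, n)) * a i * (f (i, n) * b) := by rw [h1, h2]
          _ = _ := by noncomm_ring
    _ ≤ ‖b‖ * ‖f (i, n) * a i * f (i, n)‖ * ‖b‖ :=
        (norm_mul_le _ _).trans (by gcongr; exact norm_mul_le _ _)
    _ ≤ 1 / ((n : ℝ) + 1) := by rw [hb.2.1, one_mul, mul_one]; exact hfa _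

/-- Exact simultaneous excision of countably many elements. -/
lemma IsPureState.exists_mul_mul_eq_smul {φ : C →L[ℂ] ℂ} (hφ : IsPureState φ)
    (hpp : IsQuantumPPoint φ) {ι : Type*} [Countable ι] [Nonempty ι] (z : ι → C) :
    ∃ b ∈ QuantumFilter φ, ∀ i, b * z i * b = φ (z i) • (b * b) := by
  have real : ∀ x : C, IsSelfAdjoint x → ((φ x).re : ℂ) = φ x := fun x hx =>
    Complex.ext rfl (hφ.1.im_eq_zero_of_isSelfAdjoint hx).symm
  let y : ι × Bool → C := fun p => if p.2 then ℜ (z p.1) else ℑ (z p.1)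
  have hy : ∀ p, IsSelfAdjoint (y p) := fun p => by
    simp only [y]; split_ifs; exacts [(ℜ (z p.1)).2, (ℑ (z p.1)).2]
  obtain ⟨b, hb, h⟩ := hφ.exists_mul_mul_eq_zero hpp (a := fun p => y p - (φ (y p)).re • 1)
    (fun p => (hy p).sub ((IsSelfAdjoint.all _).smul (IsSelfAdjoint.one C)))
    (fun p => by rw [map_sub, hφ.1.map_real_smul_one, real _ (hy p), sub_self])
  have h' : ∀ p, b * y p * b = φ (y p) • (b * b) := fun p => by
    have := h p
    rw [← Complex.coe_smul, real _ (hy p), mul_sub, sub_mul, mul_smul_comm, mul_one,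
      smul_mul_assoc, sub_eq_zero] at this
    exact this
  refine ⟨b, hb, fun i => ?_⟩
  have h1 : b * (ℜ (z i) : C) * b = φ (ℜ (z i)) • (b * b) := h' (i, true)
  have h2 : b * (ℑ (z i) : C) * b = φ (ℑ (z i)) • (b * b) := h' (i, false)
  conv_lhs => rw [← realPart_add_I_smul_imaginaryPart (z i)]
  conv_rhs => rw [← realPart_add_I_smul_imaginaryPart (z i)]
  rw [mul_add, add_mul, mul_smul_comm, smul_mul_assoc, h1, h2, map_add, map_smul, add_smul,
    smul_assoc]

lemma QuantumFilter.norm_mul_self {φ : C →L[ℂ] ℂ} {b : C} (hb : b ∈ QuantumFilter φ) :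
    ‖b * b‖ = 1 := by
  have := CStarRing.norm_star_mul_self (x := b)
  rwa [QuantumFilter.star_eq hb, hb.2.1, one_mul] at this

lemma IsPureState.eq_zero_of_mul_mul_eq_zero {φ : C →L[ℂ] ℂ} (hφ : IsPureState φ)
    (hpp : IsQuantumPPoint φ) {b z : C} (hb : b ∈ QuantumFilter φ) (h : b * z * b = 0) :
    φ z = 0 := by
  obtain ⟨d, hd, hdz⟩ := hφ.exists_mul_mul_eq_smul hpp fun _ : Unit => z
  obtain ⟨e, he, hed⟩ := hpp.exists_of_countable (a := fun i : Bool => if i then b else d)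
    (fun i => by cases i <;> simpa)
  have h1 : e * b = e := by simpa using hed true
  have h2 : e * d = e := by simpa using hed false
  have h3 := QuantumFilter.mul_eq_of_mul_eq he hb h1
  have h4 := QuantumFilter.mul_eq_of_mul_eq he hd h2
  have h5 : φ z • (e * e) = 0 :=
    calc φ z • (e * e) = e * (φ z • (d * d)) * e := by
          rw [mul_smul_comm, smul_mul_assoc, ← mul_assoc e, h2, mul_assoc, h4]
      _ = (e * d) * z * (d * e) := by rw [← hdz ()]; noncomm_ring
      _ = (e * b) * z * (b * e) := by rw [h1, h2, h3, h4]
      _ = e * (b * z * b) * e := by noncomm_ring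
      _ = 0 := by rw [h]; simp
  refine (smul_eq_zero.1 h5).resolve_right fun h6 => ?_
  have := QuantumFilter.norm_mul_self he
  rw [h6, norm_zero] at this
  exact zero_ne_one this

/-- The degree-1 *-polynomial `b (P - s) b`. -/
def Deg1Poly.compress {A : Type*} [Ring A] [StarRing A] (P : Deg1Poly A) (b s : A) :
    Deg1Poly A where
  m := P.m
  n := P.n
  const := b * (P.const - s) * b
  a1 i j := b * P.a1 i j
  a2 i j := P.a2 i j * b
  a3 i j := b * P.a3 i j
  a4 i j := P.a4 i j * b

lemma Deg1Poly.eval_compress {A : Type*} [Ring A] [StarRing A] (P : Deg1Poly A) (b s : A)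
    (x : ℕ → A) : (P.compress b s).eval x = b * (P.eval x - s) * b := by
  simp only [Deg1Poly.eval, Deg1Poly.compress]
  rw [add_sub_assoc, mul_add, add_mul, Finset.mul_sum, Finset.sum_mul]
  congr 1
  refine Finset.sum_congr rfl fun i _ => ?_
  rw [Finset.mul_sum, Finset.sum_mul]
  refine Finset.sum_congr rfl fun j _ => ?_
  noncomm_ring

/-- Let `C` be a unital, countably degree-1 saturated C*-algebra and `φ` a pure
state on `C` such that `F_φ` is a quantum P-point.  Then `(C, φ)` is countably degree-1
saturated. -/
theorem pairSaturated_of_quantum_pPoint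
    (hCsat : CountablyDeg1Saturated C)
    (φ : C →L[ℂ] ℂ) (hpure : IsPureState φ)
    (hpp : ∀ a : ℕ → C, (∀ n, a n ∈ QuantumFilter φ) →
      ∃ b ∈ QuantumFilter φ, ∀ n, b * a n = b) :
    PairCountablyDeg1Saturated φ := by
  intro P isNorm s hsat
  choose x hx using fun n : ℕ =>
    hsat (Finset.range (n + 1)) (1 / ((n : ℝ) + 1)) (by positivity)
  obtain ⟨b, hb, hbz⟩ := hpure.exists_mul_mul_eq_smul hpp
    fun p : ℕ × ℕ => (P p.2).eval (x p.1)
  let Q : ℕ → Deg1Poly C := fun j => if isNorm j then P j else (P j).compress b (s j • 1)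
  let r : ℕ → ℝ := fun j => if isNorm j then ‖s j‖ else 0
  have hQ : ∀ n j, j < n + 1 → |‖(Q j).eval (x n)‖ - r j| < 1 / ((n : ℝ) + 1) := by
    intro n j hj
    have h1 := hx n j (Finset.mem_range.2 hj)
    by_cases hn : isNorm j
    · simp only [Q, r, hn, if_true] at h1 ⊢
      refine lt_of_le_of_lt ?_ h1
      simpa using abs_norm_sub_norm_le (‖(P j).eval (x n)‖ : ℂ) (s j)
    · simp only [Q, r, hn, if_false, Bool.false_eq_true] at h1 ⊢
      have h2 : b * ((P j).eval (x n) - s j • 1) * b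
          = (φ ((P j).eval (x n)) - s j) • (b * b) := by
        rw [mul_sub, sub_mul, hbz (n, j), mul_smul_comm, smul_mul_assoc, mul_one, sub_smul]
      rw [Deg1Poly.eval_compress, h2, norm_smul, QuantumFilter.norm_mul_self hb, mul_one, sub_zero,
        abs_norm]
      exact h1
  obtain ⟨y, hy⟩ := hCsat Q r (fun j => by simp only [r]; split_ifs <;> positivity)
    fun F ε hε => by
      obtain ⟨n, hn⟩ := exists_nat_one_div_lt hε
      obtain ⟨m, hm⟩ := F.exists_nat_subset_range
      refine ⟨x (max n m), fun j hj => ?_⟩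
      refine (hQ (max n m) j ?_).trans_le (le_trans ?_ hn.le)
      · have := Finset.mem_range.1 (hm hj)
        omega
      · gcongr
        exact le_max_left n m
  refine ⟨y, fun j => ?_⟩
  have hyj := hy j
  by_cases hn : isNorm j
  · simp only [Q, r, hn, if_true] at hyj ⊢
    rw [hyj]
    refine eq_of_forall_dist_le fun ε hε => ?_
    obtain ⟨c, hc⟩ := hsat {j} (ε / 2) (half_pos hε)
    have h1 := hc j (Finset.mem_singleton_self j)
    simp only [hn, if_true] at h1
    have h2 : |‖(P j).eval c‖ - ‖s j‖| ≤ ‖(‖(P j).eval c‖ : ℂ) - s j‖ := by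
      simpa using abs_norm_sub_norm_le (‖(P j).eval c‖ : ℂ) (s j)
    have h3 : dist (‖s j‖ : ℂ) (‖(P j).eval c‖ : ℂ) = |‖(P j).eval c‖ - ‖s j‖| := by
      rw [Complex.dist_of_im_eq (by simp), dist_comm]; simp [Real.dist_eq]
    have h4 := dist_triangle (‖s j‖ : ℂ) (‖(P j).eval c‖ : ℂ) (s j)
    rw [h3, dist_eq_norm (‖(P j).eval c‖ : ℂ)] at h4
    linarith
  · simp only [Q, r, hn, if_false, Bool.false_eq_true, Deg1Poly.eval_compress,
      norm_eq_zero] at hyj ⊢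
    have := hpure.eq_zero_of_mul_mul_eq_zero hpp hb hyj
    rw [map_sub, map_smul, hpure.1.1, smul_eq_mul, mul_one] at this
    exact sub_eq_zero.1 this

end
end

section
/- Let C be a unital C*-algebra, p, q ∈ C projections (p = p* = p², q = q* = q²), and t ∈ [0,1). If p ≤ q + t(1 − q), then p ≤ q. -/
/-- Let `C` be a unital C*-algebra, `p, q ∈ C` projections and `t ∈ [0,1)`.
If `p ≤ q + t(1 - q)`, then `p ≤ q`. -/
theorem projection_le_of_le_add_smul
    {C : Type*} [CStarAlgebra C] [PartialOrder C] [StarOrderedRing C]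
    (p q : C) (hp₁ : star p = p) (hp₂ : p * p = p)
    (hq₁ : star q = q) (hq₂ : q * q = q)
    (t : ℝ) (ht₀ : 0 ≤ t) (ht₁ : t < 1)
    (h : p ≤ q + (t : ℂ) • (1 - q)) : p ≤ q := by
  have hp : IsStarProjection p := ⟨hp₂, hp₁⟩
  have hq : IsStarProjection q := ⟨hq₂, hq₁⟩
  have hx : star ((1 - q) * p) * ((1 - q) * p) = p - p * q * p := by
    simp only [star_mul, star_sub, star_one, hp₁, hq₁]
    have h₁ : (1 - q) * (1 - q) = 1 - q := hq.one_sub.isIdempotentElem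
    rw [mul_assoc, ← mul_assoc (1 - q), h₁, sub_mul, mul_sub, one_mul, hp₂, mul_assoc]
  have h_le : p - p * q * p ≤ (t : ℂ) • (p - p * q * p) := by
    have h₁ := star_left_conjugate_le_conjugate h p
    rw [hp₁, hp₂, hp₂, mul_add, add_mul, mul_smul_comm, smul_mul_assoc, mul_sub, sub_mul,
      mul_one, hp₂] at h₁
    exact sub_le_iff_le_add'.mpr h₁
  rw [← hx] at h_le
  have h_norm := CStarAlgebra.norm_le_norm_of_nonneg_of_le (star_mul_self_nonneg _) h_le
  rw [norm_smul, Complex.norm_real, Real.norm_of_nonneg ht₀] at h_norm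
  have h_zero : star ((1 - q) * p) * ((1 - q) * p) = 0 := by
    rw [← norm_le_zero_iff]
    nlinarith
  rw [CStarRing.star_mul_self_eq_zero_iff, sub_mul, one_mul, sub_eq_zero] at h_zero
  exact (hp.le_iff_mul_eq_right hq).mpr h_zero.symm
end
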